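/- arXiv:1906.09783 — 2 statements merged into one kernel-verified Lean document; each statement's English description precedes it below -/
import Mathlib

section
/- Let G = (V, E, w) be a weighted graph, Δ > 0 a parameter, and τ ≥ 1. Suppose N ⊆ V is a set of center vertices such that for every v ∈ V: (covering) there exists x ∈ N with d_G(v, x) ≤ Δ; and (packing) |B_G(v, 3Δ) ∩ N| ≤ τ. Then G admits a strongly (32(1 + ln τ), 1/16, 4Δ)-padded decomposition: there is a probability distribution D over partitions of V such that every partition in the support of D is strongly 4Δ-bounded, and for every z ∈ V and every 0 ≤ γ ≤ 1/16, Pr_{P∼D}[B_G(z, 4γΔ) ⊆ P(z)] ≥ e^{-32(1+ln τ)γ}, where P(z) denotes the cluster of P containing z. -/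
open MeasureTheory

namespace Pad

variable {V : Type*}

/-- The weight of a walk: the sum of the weights of its edges. -/
def walkWeight (w : Sym2 V → ℝ) {G : SimpleGraph V} {u v : V} (p : G.Walk u v) : ℝ :=
  (p.darts.map fun d => w d.edge).sum

/-- Shortest-path distance in the weighted graph `(G, w)`. -/
noncomputable def wdist (w : Sym2 V → ℝ) (G : SimpleGraph V) (u v : V) : ℝ :=
  sInf {x | ∃ p : G.Walk u v, x = walkWeight w p}

/-- Distance from a vertex to a set of vertices. -/
noncomputable def wdistSet (w : Sym2 V → ℝ) (G : SimpleGraph V) (v : V) (A : Set V) : ℝ :=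
  sInf {x | ∃ a ∈ A, x = wdist w G v a}

/-- The closed ball of radius `r` around `v`. -/
def ball (w : Sym2 V → ℝ) (G : SimpleGraph V) (v : V) (r : ℝ) : Set V :=
  {u | wdist w G v u ≤ r}

/-- Weight of a walk of an induced subgraph, measured with the weights of `G`. -/
def walkWeightI (w : Sym2 V → ℝ) {G : SimpleGraph V} {C : Set V} {u v : C}
    (p : (G.induce C).Walk u v) : ℝ :=
  (p.darts.map fun d => w (Sym2.map Subtype.val d.edge)).sum

/-- The cluster `C` has strong diameter at most `Δ`: every two vertices of `C` are joined,
inside the induced subgraph `G[C]`, by a walk of weight at most `Δ`. -/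
def StronglyBounded (w : Sym2 V → ℝ) (G : SimpleGraph V) (C : Set V) (Δ : ℝ) : Prop :=
  ∀ u v : C, ∃ p : (G.induce C).Walk u v, walkWeightI w p ≤ Δ

/-- A partition of `V`, given by the map `cl` sending a vertex to its cluster. -/
structure Partition (V : Type*) where
  cl : V → Set V
  mem_cl : ∀ v, v ∈ cl v
  cl_eq : ∀ u v, u ∈ cl v → cl u = cl v

/-- A partition is strongly `Δ`-bounded if each of its clusters has strong diameter at most `Δ`. -/
def Partition.StronglyBounded (w : Sym2 V → ℝ) (G : SimpleGraph V) (P : Partition V)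
    (Δ : ℝ) : Prop :=
  ∀ v : V, Pad.StronglyBounded w G (P.cl v) Δ

/-- `(G, w)` has doubling dimension `ddim`: every ball of radius `2r` can be covered by
`2 ^ ddim` balls of radius `r`. -/
def Doubling (w : Sym2 V → ℝ) (G : SimpleGraph V) (ddim : ℝ) : Prop :=
  ∀ (x : V) (r : ℝ), 0 < r → ∃ T : Set V, T.Finite ∧ ((T.ncard : ℝ) ≤ (2 : ℝ) ^ ddim) ∧
    ball w G x (2 * r) ⊆ ⋃ y ∈ T, ball w G y r

/-- `G` has the complete graph `K_r` as a minor: there are `r` pairwise disjoint connected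
branch sets with an edge of `G` between any two of them. -/
def HasCliqueMinor (G : SimpleGraph V) (r : ℕ) : Prop :=
  ∃ B : Fin r → Set V,
    (∀ i, (G.induce (B i)).Connected) ∧
    (Pairwise fun i j => Disjoint (B i) (B j)) ∧
    ∀ i j : Fin r, i ≠ j → ∃ u ∈ B i, ∃ v ∈ B j, G.Adj u v

/-- A shortest path: a path whose weight equals the distance between its endpoints. -/
def IsShortestPath (w : Sym2 V → ℝ) (G : SimpleGraph V) {u v : V} (p : G.Walk u v) : Prop :=
  p.IsPath ∧ walkWeight w p = wdist w G u v

/-- `G` has an `r`-core with radius `Δ`: there are at most `r` shortest paths such that every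
vertex is within distance `Δ` of their union. -/
def HasCore (w : Sym2 V → ℝ) (G : SimpleGraph V) (r : ℕ) (Δ : ℝ) : Prop :=
  ∃ r' : ℕ, r' ≤ r ∧ ∃ (a b : Fin r' → V) (p : ∀ i, G.Walk (a i) (b i)),
    (∀ i, IsShortestPath w G (p i)) ∧
    ∀ v : V, ∃ i, ∃ u ∈ (p i).support, wdist w G v u ≤ Δ

end Pad

namespace Pad

section TruncatedExponential

open Set ProbabilityTheory

/-- The exponential distribution of rate `r`, conditioned on the interval `[0, L]`. -/
noncomputable def truncExp (r L : ℝ) : Measure ℝ :=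
  ProbabilityTheory.cond (expMeasure r) (Icc 0 L)

lemma expMeasure_real_Ioc {r a b : ℝ} (hr : 0 < r) (ha : 0 ≤ a) (hab : a ≤ b) :
    (expMeasure r).real (Ioc a b) = Real.exp (-(r * a)) - Real.exp (-(r * b)) := by
  have := isProbabilityMeasure_expMeasure hr
  rw [← Iic_sdiff_Iic, measureReal_sdiff (Iic_subset_Iic.2 hab) measurableSet_Iic,
    ← cdf_eq_real, ← cdf_eq_real, cdf_expMeasure_eq hr, cdf_expMeasure_eq hr,
    if_pos ha, if_pos (ha.trans hab)]
  ring

lemma expMeasure_real_Icc {r a b : ℝ} (hr : 0 < r) (ha : 0 ≤ a) (hab : a ≤ b) :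
    (expMeasure r).real (Icc a b) = Real.exp (-(r * a)) - Real.exp (-(r * b)) := by
  have : NullSingletonClass (expMeasure r) := by
    unfold expMeasure gammaMeasure
    infer_instance
  rw [← expMeasure_real_Ioc hr ha hab]
  exact measureReal_congr Ioc_ae_eq_Icc.symm

lemma exp_neg_mul_lt_one {r L : ℝ} (hr : 0 < r) (hL : 0 < L) : Real.exp (-(r * L)) < 1 := by
  rw [Real.exp_lt_one_iff]
  nlinarith [mul_pos hr hL]

lemma isProbabilityMeasure_truncExp {r L : ℝ} (hr : 0 < r) (hL : 0 < L) :
    IsProbabilityMeasure (truncExp r L) := by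
  have := isProbabilityMeasure_expMeasure hr
  refine cond_isProbabilityMeasure fun h => ?_
  have h1 := expMeasure_real_Icc hr le_rfl hL.le
  rw [measureReal_def, h] at h1
  simp only [ENNReal.toReal_zero, mul_zero, neg_zero, Real.exp_zero] at h1
  linarith [exp_neg_mul_lt_one hr hL]

lemma truncExp_real_apply {r L : ℝ} (hr : 0 < r) (hL : 0 < L) (A : Set ℝ) :
    (truncExp r L).real A =
      (1 - Real.exp (-(r * L)))⁻¹ * (expMeasure r).real (Icc 0 L ∩ A) := by
  have h := expMeasure_real_Icc hr le_rfl hL.le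
  rw [mul_zero, neg_zero, Real.exp_zero] at h
  rw [← h, truncExp, measureReal_def, cond_apply measurableSet_Icc, ENNReal.toReal_mul,
    ENNReal.toReal_inv]
  rfl

lemma truncExp_ae_mem {r L : ℝ} : ∀ᵐ x ∂truncExp r L, x ∈ Icc 0 L :=
  ae_cond_mem measurableSet_Icc

/-- The truncated exponential distribution is memoryless up to an additive error. -/
lemma truncExp_real_Icc_le {r L s : ℝ} (hr : 0 < r) (hL : 0 < L) (hs : 0 ≤ s) (ρ : ℝ) :
    (truncExp r L).real (Icc ρ (ρ + s)) ≤
      (1 - Real.exp (-(r * s))) *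
        ((truncExp r L).real (Ioi ρ) + (Real.exp (r * L) - 1)⁻¹) := by
  have := isProbabilityMeasure_expMeasure hr
  have h1 := exp_neg_mul_lt_one hr hL
  have h0 : 0 < Real.exp (-(r * L)) := Real.exp_pos _
  have hs1 : Real.exp (-(r * s)) ≤ 1 := by
    rw [Real.exp_le_one_iff]; nlinarith [mul_nonneg hr.le hs]
  have hκ : (Real.exp (r * L) - 1)⁻¹ =
      (1 - Real.exp (-(r * L)))⁻¹ * Real.exp (-(r * L)) := by
    have he : Real.exp (r * L) = (Real.exp (-(r * L)))⁻¹ := by rw [Real.exp_neg, inv_inv]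
    rw [he]
    have h3 : 1 - Real.exp (-(r * L)) ≠ 0 := by linarith
    rw [inv_eq_iff_eq_inv, mul_inv, inv_inv]
    field_simp
  rw [truncExp_real_apply hr hL, truncExp_real_apply hr hL, hκ, ← mul_add, mul_left_comm]
  refine mul_le_mul_of_nonneg_left ?_ (inv_nonneg.2 (by linarith))
  rcases lt_or_ge ρ 0 with hρ | hρ
  · have hA : Icc 0 L ∩ Ioi ρ = Icc 0 L :=
      inter_eq_left.2 fun x hx => lt_of_lt_of_le hρ hx.1
    have hB : Icc 0 L ∩ Icc ρ (ρ + s) ⊆ Icc 0 s := fun x hx => ⟨hx.1.1, by linarith [hx.2.2]⟩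
    refine (measureReal_mono hB).trans ?_
    rw [hA, expMeasure_real_Icc hr le_rfl hs, expMeasure_real_Icc hr le_rfl hL.le]
    simp
  rcases le_or_gt ρ L with hρL | hρL
  · have hA : Icc 0 L ∩ Ioi ρ = Ioc ρ L := by
      ext x
      simp only [mem_inter_iff, mem_Icc, mem_Ioi, mem_Ioc]
      exact ⟨fun h => ⟨h.2, h.1.2⟩, fun h => ⟨⟨hρ.trans h.1.le, h.2⟩, h.1⟩⟩
    refine (measureReal_mono inter_subset_right).trans ?_
    rw [hA, expMeasure_real_Icc hr hρ (by linarith), expMeasure_real_Ioc hr hρ hρL,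
      mul_add r, neg_add, Real.exp_add]
    linarith
  · have hA : Icc 0 L ∩ Icc ρ (ρ + s) = ∅ :=
      eq_empty_of_forall_notMem fun x hx => by linarith [hx.1.2, hx.2.1]
    rw [hA, measureReal_empty]
    exact mul_nonneg (by linarith) (add_nonneg measureReal_nonneg h0.le)

end TruncatedExponential

section Distance

variable {w : Sym2 V → ℝ} {G : SimpleGraph V}

lemma walkWeight_nonneg (hw : ∀ e, 0 ≤ w e) {u v : V} (p : G.Walk u v) :
    0 ≤ walkWeight w p := by
  refine List.sum_nonneg fun x hx => ?_
  obtain ⟨d, -, rfl⟩ := List.mem_map.1 hx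
  exact hw _

lemma walkWeight_cons {u v x : V} (h : G.Adj u v) (p : G.Walk v x) :
    walkWeight w (p.cons h) = w s(u, v) + walkWeight w p := by
  simp [walkWeight, SimpleGraph.Dart.edge]

lemma walkWeight_append {u v x : V} (p : G.Walk u v) (q : G.Walk v x) :
    walkWeight w (p.append q) = walkWeight w p + walkWeight w q := by
  simp [walkWeight]

lemma walkWeight_reverse {u v : V} (p : G.Walk u v) :
    walkWeight w p.reverse = walkWeight w p := by
  simp [walkWeight, SimpleGraph.Walk.darts_reverse, List.sum_reverse, Function.comp_def]

lemma walkWeight_bypass_le [DecidableEq V] (hw : ∀ e, 0 ≤ w e) {u v : V} (p : G.Walk u v) :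
    walkWeight w p.bypass ≤ walkWeight w p := by
  refine (p.darts_bypass_sublist_darts.map _).sum_le_sum fun x hx => ?_
  obtain ⟨d, -, rfl⟩ := List.mem_map.1 hx
  exact hw _

lemma wdist_le (hw : ∀ e, 0 ≤ w e) {u v : V} (p : G.Walk u v) :
    wdist w G u v ≤ walkWeight w p :=
  csInf_le ⟨0, by rintro _ ⟨q, rfl⟩; exact walkWeight_nonneg hw q⟩ ⟨p, rfl⟩

lemma exists_walkWeight_eq_wdist [Finite V] (hG : G.Connected) (hw : ∀ e, 0 ≤ w e) (u v : V) :
    ∃ p : G.Walk u v, walkWeight w p = wdist w G u v := by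
  classical
  have := Fintype.ofFinite V
  obtain ⟨q⟩ := hG.preconnected u v
  have : Nonempty (G.Path u v) := ⟨q.toPath⟩
  obtain ⟨p, hp⟩ := Finite.exists_min fun p : G.Path u v => walkWeight w p.1
  refine ⟨p.1, le_antisymm (le_csInf ⟨_, q, rfl⟩ ?_) (wdist_le hw _)⟩
  rintro _ ⟨q', rfl⟩
  exact (hp q'.toPath).trans (walkWeight_bypass_le hw q')

lemma wdist_triangle [Finite V] (hG : G.Connected) (hw : ∀ e, 0 ≤ w e) (u v x : V) :
    wdist w G u x ≤ wdist w G u v + wdist w G v x := by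
  obtain ⟨p, hp⟩ := exists_walkWeight_eq_wdist hG hw u v
  obtain ⟨q, hq⟩ := exists_walkWeight_eq_wdist hG hw v x
  rw [← hp, ← hq, ← walkWeight_append]
  exact wdist_le hw _

lemma wdist_comm (u v : V) : wdist w G u v = wdist w G v u := by
  unfold wdist
  congr 1
  ext x
  constructor <;> rintro ⟨p, rfl⟩ <;> exact ⟨p.reverse, (walkWeight_reverse p).symm⟩

lemma wdist_le_of_adj (hw : ∀ e, 0 ≤ w e) {u v : V} (h : G.Adj u v) :
    wdist w G u v ≤ w s(u, v) := by
  simpa [walkWeight, SimpleGraph.Dart.edge] using wdist_le hw h.toWalk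

lemma walkWeightI_append {C : Set V} {u v x : C} (p : (G.induce C).Walk u v)
    (q : (G.induce C).Walk v x) :
    walkWeightI w (p.append q) = walkWeightI w p + walkWeightI w q := by
  simp [walkWeightI]

lemma walkWeightI_reverse {C : Set V} {u v : C} (p : (G.induce C).Walk u v) :
    walkWeightI w p.reverse = walkWeightI w p := by
  simp [walkWeightI, SimpleGraph.Walk.darts_reverse, List.sum_reverse, Function.comp_def]

end Distance

/-- The partition of `V` into the fibres of a map. -/
def Partition.ofFibres {α : Type*} (g : V → α) : Partition V where
  cl v := {u | g u = g v}
  mem_cl _ := rfl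
  cl_eq u v h := by
    have h : g u = g v := h
    simp only [h]

section Clustering

variable (w : Sym2 V → ℝ) (G : SimpleGraph V)

/-- The value of the center `t` for the vertex `v`, when the center `t` is shifted by `δ t`. -/
noncomputable def shiftedValue (δ : V → ℝ) (v t : V) : ℝ := δ t - wdist w G v t

/-- The center `t ∈ N` has the largest shifted value for `v`, ties being broken by `e`. -/
def Wins (N : Set V) (e : V → ℕ) (δ : V → ℝ) (v t : V) : Prop :=
  t ∈ N ∧ ∀ s ∈ N, shiftedValue w G δ v s < shiftedValue w G δ v t ∨
    shiftedValue w G δ v s = shiftedValue w G δ v t ∧ e s ≤ e t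

variable {w G} {N : Set V} {e : V → ℕ} {δ : V → ℝ}

lemma shiftedValue_update_of_ne [DecidableEq V] (δ : V → ℝ) {z t x : V} (hx : x ≠ t) (y : ℝ) :
    shiftedValue w G (Function.update δ t y) z x = shiftedValue w G δ z x := by
  simp [shiftedValue, hx]

lemma shiftedValue_update_self [DecidableEq V] (δ : V → ℝ) (z t : V) (y : ℝ) :
    shiftedValue w G (Function.update δ t y) z t = y - wdist w G z t := by
  simp [shiftedValue]

lemma exists_wins [Finite V] (hN : N.Nonempty) (v : V) : ∃ t, Wins w G N e δ v t := by
  obtain ⟨t, ht, h⟩ := Set.exists_max_image N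
    (fun t => toLex (shiftedValue w G δ v t, e t)) N.toFinite hN
  exact ⟨t, ht, fun s hs => by simpa [Prod.Lex.le_iff] using h s hs⟩

lemma Wins.le {v t s : V} (h : Wins w G N e δ v t) (hs : s ∈ N) :
    shiftedValue w G δ v s ≤ shiftedValue w G δ v t :=
  (h.2 s hs).elim le_of_lt fun h => h.1.le

lemma Wins.unique (he : Function.Injective e) {v t s : V} (ht : Wins w G N e δ v t)
    (hs : Wins w G N e δ v s) : t = s := by
  apply he
  have h1 := ht.2 s hs.1
  have h2 := hs.2 t ht.1
  rcases h1 with h1 | h1 <;> rcases h2 with h2 | h2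
  · exact absurd h1 h2.not_gt
  · exact absurd h1 h2.1.not_gt
  · exact absurd h2 h1.1.not_gt
  · exact le_antisymm h2.2 h1.2

/-- The winner of `v` also wins at the next vertex of a shortest path from `v` to the winner. -/
lemma Wins.of_adj [Finite V] (hG : G.Connected) (hw : ∀ e, 0 ≤ w e) {v u t : V}
    (h : Wins w G N e δ v t) (hvu : G.Adj v u)
    (hd : w s(v, u) + wdist w G u t ≤ wdist w G v t) : Wins w G N e δ u t := by
  refine ⟨h.1, fun s hs => ?_⟩
  have h1 := wdist_triangle hG hw v u s
  have h2 := wdist_le_of_adj hw hvu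
  have h3 := h.2 s hs
  unfold shiftedValue at h3 ⊢
  rcases h3 with h3 | ⟨h3, h4⟩
  · left; linarith
  · rcases (show δ s - wdist w G u s ≤ δ t - wdist w G u t by linarith).lt_or_eq with h5 | h5
    · exact Or.inl h5
    · exact Or.inr ⟨h5, h4⟩

lemma Wins.exists_induce_walk [Finite V] (hG : G.Connected) (hw : ∀ e, 0 ≤ w e) {v t : V}
    (p : G.Walk v t) (hp : walkWeight w p = wdist w G v t) (h : Wins w G N e δ v t)
    (C : Set V) (hC : ∀ u, Wins w G N e δ u t → u ∈ C) :
    ∃ (hv : v ∈ C) (ht : t ∈ C) (q : (G.induce C).Walk ⟨v, hv⟩ ⟨t, ht⟩),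
      walkWeightI w q = walkWeight w p := by
  induction p with
  | nil => exact ⟨hC _ h, hC _ h, .nil, by simp [walkWeightI, walkWeight]⟩
  | @cons v u t hvu p ih =>
    have h1 := wdist_triangle hG hw v u t
    have h2 := wdist_le_of_adj hw hvu
    have h3 := wdist_le hw p
    rw [walkWeight_cons] at hp
    obtain ⟨hu, ht, q, hq⟩ := ih (by linarith) (h.of_adj hG hw hvu (by linarith)) hC
    refine ⟨hC _ h, ht, .cons (by simpa using hvu) q, ?_⟩
    rw [walkWeight_cons, ← hq]
    simp [walkWeightI, SimpleGraph.Dart.edge]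

lemma Wins.wdist_le {Δ : ℝ} (hcov : ∀ v : V, ∃ x ∈ N, wdist w G v x ≤ Δ)
    (hδ : ∀ t, δ t ∈ Set.Icc 0 Δ) {v t : V} (h : Wins w G N e δ v t) :
    wdist w G v t ≤ 2 * Δ := by
  obtain ⟨x, hx, hvx⟩ := hcov v
  have := h.le hx
  unfold shiftedValue at this
  linarith [(hδ x).1, (hδ t).2]

lemma stronglyBounded_ofFibres [Finite V] (hG : G.Connected) (hw : ∀ e, 0 ≤ w e) {Δ : ℝ}
    (hcov : ∀ v : V, ∃ x ∈ N, wdist w G v x ≤ Δ) (hδ : ∀ t, δ t ∈ Set.Icc 0 Δ)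
    (he : Function.Injective e) {g : V → V} (hg : ∀ v, Wins w G N e δ v (g v)) :
    (Partition.ofFibres g).StronglyBounded w G (4 * Δ) := by
  intro v
  have key : ∀ u : (Partition.ofFibres g).cl v, ∃ (ht : g v ∈ (Partition.ofFibres g).cl v)
      (q : (G.induce ((Partition.ofFibres g).cl v)).Walk u ⟨g v, ht⟩),
      walkWeightI w q ≤ 2 * Δ := by
    rintro ⟨u, hu⟩
    have hu' : g u = g v := hu
    have hwin : Wins w G N e δ u (g v) := hu' ▸ hg u
    obtain ⟨p, hp⟩ := exists_walkWeight_eq_wdist hG hw u (g v)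
    obtain ⟨_, ht, q, hq⟩ := hwin.exists_induce_walk hG hw p hp ((Partition.ofFibres g).cl v)
      fun x hx => (hg x).unique he hx
    exact ⟨ht, q, by rw [hq, hp]; exact hwin.wdist_le hcov hδ⟩
  intro a b
  obtain ⟨_, p, hp⟩ := key a
  obtain ⟨_, q, hq⟩ := key b
  refine ⟨p.append q.reverse, ?_⟩
  rw [walkWeightI_append, walkWeightI_reverse]
  linarith

/-- The event that `t` wins at `z`, but some other center is within `s` of it. -/
def Cut (w : Sym2 V → ℝ) (G : SimpleGraph V) (N : Set V) (e : V → ℕ) (s : ℝ) (z t : V) :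
    Set (V → ℝ) :=
  {δ | Wins w G N e δ z t ∧
    ∃ x ∈ N, x ≠ t ∧ shiftedValue w G δ z t ≤ shiftedValue w G δ z x + s}

lemma ball_subset_of_notMem_cut [Finite V] (hG : G.Connected) (hw : ∀ e, 0 ≤ w e)
    (he : Function.Injective e) {g : V → V} (hg : ∀ v, Wins w G N e δ v (g v)) {s : ℝ} {z : V}
    (hz : δ ∉ Cut w G N e (2 * s) z (g z)) :
    ball w G z s ⊆ (Partition.ofFibres g).cl z := by
  intro u hu
  have hu : wdist w G z u ≤ s := hu
  refine (hg u).unique he ⟨(hg z).1, fun x hx => ?_⟩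
  by_cases hxt : x = g z
  · exact Or.inr ⟨by rw [hxt], by rw [hxt]⟩
  left
  have h1 : ¬ shiftedValue w G δ z (g z) ≤ shiftedValue w G δ z x + 2 * s :=
    fun h => hz ⟨hg z, x, hx, hxt, h⟩
  have h2 := wdist_triangle hG hw z u x
  have h3 := wdist_triangle hG hw u z (g z)
  rw [wdist_comm u z] at h3
  unfold shiftedValue at h1 ⊢
  linarith

lemma measurable_shiftedValue (v t : V) : Measurable fun δ => shiftedValue w G δ v t :=
  (measurable_pi_apply t).sub_const _

lemma measurableSet_wins [Finite V] (v t : V) : MeasurableSet {δ | Wins w G N e δ v t} := by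
  simp only [Wins, Set.ofPred_and, Set.ofPred_forall, Set.ofPred_or]
  refine (MeasurableSet.const _).inter (.iInter fun s => .iInter fun _ => .union ?_ ?_)
  · exact measurableSet_lt (measurable_shiftedValue v s) (measurable_shiftedValue v t)
  · exact (measurableSet_eq_fun (measurable_shiftedValue v s)
      (measurable_shiftedValue v t)).inter (MeasurableSet.const _)

lemma measurableSet_cut [Finite V] (s : ℝ) (z t : V) : MeasurableSet (Cut w G N e s z t) := by
  simp only [Cut, Set.ofPred_and, Set.ofPred_exists]
  refine (measurableSet_wins z t).inter (.iUnion fun x =>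
    (MeasurableSet.const _).inter ((MeasurableSet.const _).inter ?_))
  exact measurableSet_le (measurable_shiftedValue z t) ((measurable_shiftedValue z x).add_const s)

end Clustering

section Probability

variable [Fintype V] {w : Sym2 V → ℝ} {G : SimpleGraph V} {N : Set V} {e : V → ℕ}

/-- The joint law of independent truncated exponential shifts, one for each vertex. -/
noncomputable def shiftLaw (V : Type*) [Fintype V] (r L : ℝ) : Measure (V → ℝ) :=
  Measure.pi fun _ => truncExp r L

lemma isProbabilityMeasure_shiftLaw {r L : ℝ} (hr : 0 < r) (hL : 0 < L) :
    IsProbabilityMeasure (shiftLaw V r L) := by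
  have := isProbabilityMeasure_truncExp hr hL
  unfold shiftLaw
  infer_instance

lemma shiftLaw_ae_mem {r L : ℝ} (hr : 0 < r) (hL : 0 < L) :
    ∀ᵐ δ ∂shiftLaw V r L, ∀ t, δ t ∈ Set.Icc 0 L := by
  have := isProbabilityMeasure_truncExp hr hL
  refine ae_all_iff.2 fun t => ?_
  exact (Measure.quasiMeasurePreserving_eval (fun _ : V => truncExp r L) t).ae truncExp_ae_mem

/-- When all shifts but that of `t` are fixed, the cut event confines the shift of `t` to an
interval of length `s`, and `t` wins as soon as its shift exceeds the left end. -/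
lemma exists_cut_threshold [DecidableEq V] (s : ℝ) (δ : V → ℝ) {z t : V} (ht : t ∈ N)
    (hN : ∃ x ∈ N, x ≠ t) :
    ∃ ρ : ℝ, (∀ y, Function.update δ t y ∈ Cut w G N e s z t → y ∈ Set.Icc ρ (ρ + s)) ∧
      ∀ y, ρ < y → Wins w G N e (Function.update δ t y) z t := by
  obtain ⟨m, ⟨hm, hmt⟩, hmax⟩ := Set.exists_max_image {x | x ∈ N ∧ x ≠ t}
    (shiftedValue w G δ z) (Set.toFinite _) hN
  refine ⟨shiftedValue w G δ z m + wdist w G z t, ?_, fun y hy => ⟨ht, fun x hx => ?_⟩⟩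
  · rintro y ⟨hwin, x, hx, hxt, hle⟩
    have h1 := hwin.le hm
    have h2 := hmax x ⟨hx, hxt⟩
    rw [shiftedValue_update_self] at h1 hle
    rw [shiftedValue_update_of_ne _ hmt] at h1
    rw [shiftedValue_update_of_ne _ hxt] at hle
    constructor <;> linarith
  · by_cases hxt : x = t
    · exact Or.inr ⟨by rw [hxt], by rw [hxt]⟩
    · left
      have h2 := hmax x ⟨hx, hxt⟩
      rw [shiftedValue_update_self, shiftedValue_update_of_ne _ hxt]
      linarith

lemma shiftLaw_cut_le {r L s : ℝ} (hr : 0 < r) (hL : 0 < L) (hs : 0 ≤ s) (z t : V) :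
    (shiftLaw V r L).real (Cut w G N e s z t) ≤ (1 - Real.exp (-(r * s))) *
      ((shiftLaw V r L).real {δ | Wins w G N e δ z t} + (Real.exp (r * L) - 1)⁻¹) := by
  classical
  have := isProbabilityMeasure_truncExp hr hL
  have := isProbabilityMeasure_shiftLaw (V := V) hr hL
  have hc : 0 ≤ 1 - Real.exp (-(r * s)) := by
    rw [sub_nonneg, Real.exp_le_one_iff]
    nlinarith [mul_nonneg hr.le hs]
  have hκ : 0 ≤ (Real.exp (r * L) - 1)⁻¹ :=
    inv_nonneg.2 (sub_nonneg.2 (Real.one_le_exp (mul_pos hr hL).le))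
  by_cases hN : t ∈ N ∧ ∃ x ∈ N, x ≠ t
  swap
  · have : Cut w G N e s z t = ∅ := Set.eq_empty_of_forall_notMem fun δ hδ =>
      hN ⟨hδ.1.1, let ⟨x, hx, hxt, _⟩ := hδ.2; ⟨x, hx, hxt⟩⟩
    rw [this, measureReal_empty]
    exact mul_nonneg hc (add_nonneg measureReal_nonneg hκ)
  have hW := measurableSet_wins (w := w) (G := G) (N := N) (e := e) z t
  have hC := measurableSet_cut (w := w) (G := G) (N := N) (e := e) s z t
  set c := ENNReal.ofReal (1 - Real.exp (-(r * s)))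
  set K := ENNReal.ofReal (Real.exp (r * L) - 1)⁻¹
  have key : ∫⁻ δ, (Cut w G N e s z t).indicator 1 δ ∂shiftLaw V r L ≤
      ∫⁻ δ, c * ({δ | Wins w G N e δ z t}.indicator 1 δ + K) ∂shiftLaw V r L := by
    refine lintegral_le_of_lmarginal_le {t} (measurable_one.indicator hC)
      (((measurable_one.indicator hW).add_const K).const_mul c) fun δ => ?_
    rw [lmarginal_singleton, lmarginal_singleton]
    obtain ⟨ρ, h1, h2⟩ := exists_cut_threshold (w := w) (G := G) (e := e) s δ (z := z) hN.1 hN.2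
    calc ∫⁻ y, (Cut w G N e s z t).indicator 1 (Function.update δ t y) ∂truncExp r L
        ≤ ∫⁻ y, (Set.Icc ρ (ρ + s)).indicator 1 y ∂truncExp r L := by
          refine lintegral_mono fun y => ?_
          by_cases hy : Function.update δ t y ∈ Cut w G N e s z t
          · simp [hy, h1 y hy]
          · simp [hy]
      _ = ENNReal.ofReal ((truncExp r L).real (Set.Icc ρ (ρ + s))) := by
          rw [lintegral_indicator_one measurableSet_Icc, ofReal_measureReal]
      _ ≤ c * (truncExp r L (Set.Ioi ρ) + K) := by
          rw [← ofReal_measureReal (s := Set.Ioi ρ), ← ENNReal.ofReal_add measureReal_nonneg hκ,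
            ← ENNReal.ofReal_mul hc]
          exact ENNReal.ofReal_le_ofReal (truncExp_real_Icc_le hr hL hs ρ)
      _ = ∫⁻ y, c * ((Set.Ioi ρ).indicator 1 y + K) ∂truncExp r L := by
          rw [lintegral_const_mul _ ((measurable_one.indicator measurableSet_Ioi).add_const K),
            lintegral_add_right _ measurable_const, lintegral_indicator_one measurableSet_Ioi,
            lintegral_const, measure_univ, mul_one]
      _ ≤ _ := by
          refine lintegral_mono fun y => ?_
          gcongr
          by_cases hy : ρ < y
          · simp [hy, h2 y hy]
          · simp [hy]
  rw [lintegral_indicator_one hC,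
    lintegral_const_mul _ ((measurable_one.indicator hW).add_const K),
    lintegral_add_right _ measurable_const, lintegral_indicator_one hW,
    lintegral_const, measure_univ, mul_one, ← ofReal_measureReal, ← ofReal_measureReal,
    ← ENNReal.ofReal_add measureReal_nonneg hκ, ← ENNReal.ofReal_mul hc] at key
  exact (ENNReal.ofReal_le_ofReal_iff
    (mul_nonneg hc (add_nonneg measureReal_nonneg hκ))).1 key

lemma sum_shiftLaw_wins_le_one {r L : ℝ} (hr : 0 < r) (hL : 0 < L) (he : Function.Injective e)
    (z : V) (T : Finset V) :
    ∑ t ∈ T, (shiftLaw V r L).real {δ | Wins w G N e δ z t} ≤ 1 := by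
  have := isProbabilityMeasure_shiftLaw (V := V) hr hL
  rw [← measureReal_biUnion_finset]
  · exact measureReal_le_one
  · exact fun t _ s _ hts => Set.disjoint_left.2 fun δ h1 h2 => hts (h1.unique he h2)
  · exact fun t _ => measurableSet_wins z t

/-- With rate `2 + 2 log τ` (in units of `1 / Δ`), the padding bound holds for at most `τ`
relevant centers. -/
lemma exp_le_one_sub_of_rate {τ γ : ℝ} (hτ : 1 ≤ τ) (hγ0 : 0 ≤ γ) (hγ : γ ≤ 1 / 16) :
    Real.exp (-(32 * (1 + Real.log τ) * γ)) ≤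
      1 - (1 - Real.exp (-(16 * (1 + Real.log τ) * γ))) *
        (1 + τ * (Real.exp (2 + 2 * Real.log τ) - 1)⁻¹) := by
  have hτ0 : 0 < τ := by linarith
  have hlog := Real.log_nonneg hτ
  set α := Real.exp (-(16 * (1 + Real.log τ) * γ)) with hα
  have h1 : Real.exp (-(32 * (1 + Real.log τ) * γ)) = α * α := by
    rw [hα, ← Real.exp_add]
    ring_nf
  have hα1 : α ≤ 1 := by
    rw [hα, Real.exp_le_one_iff]
    have : 0 ≤ 16 * (1 + Real.log τ) * γ := by positivity
    linarith
  have h2 : Real.exp (2 + 2 * Real.log τ) = (Real.exp 1 * τ) * (Real.exp 1 * τ) := by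
    rw [show 2 + 2 * Real.log τ = (1 + Real.log τ) + (1 + Real.log τ) by ring, Real.exp_add,
      Real.exp_add, Real.exp_log hτ0]
  have h3 : (Real.exp 1 * τ)⁻¹ ≤ α := by
    rw [hα, ← Real.exp_log hτ0, ← Real.exp_add, ← Real.exp_neg, Real.exp_le_exp, Real.log_exp]
    nlinarith
  have he : 2 ≤ Real.exp 1 := by linarith [Real.add_one_le_exp 1]
  have h4 : τ * (Real.exp (2 + 2 * Real.log τ) - 1)⁻¹ ≤ (Real.exp 1 * τ)⁻¹ := by
    set E := Real.exp 1
    have hτ2 : 1 ≤ τ * τ := by nlinarith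
    have hE : 1 ≤ E * (E - 1) := by nlinarith
    have h5 : E * τ * τ + 1 ≤ E * τ * (E * τ) := by
      have : 1 ≤ (τ * τ) * (E * (E - 1)) := one_le_mul_of_one_le_of_one_le hτ2 hE
      nlinarith
    have h6 : 0 < E * τ * (E * τ) - 1 := by
      have : 0 < E * τ * τ := by positivity
      linarith
    rw [h2, ← div_eq_mul_inv, ← one_div, div_le_div_iff₀ h6 (by positivity)]
    linarith
  rw [h1]
  have h5 := mul_nonneg (sub_nonneg.2 hα1) (sub_nonneg.2 (h4.trans h3))
  linarith

lemma exp_le_shiftLaw_compl_cut {Δ τ : ℝ} (hΔ : 0 < Δ) (hτ : 1 ≤ τ)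
    (he : Function.Injective e) (z : V) {γ : ℝ} (hγ0 : 0 ≤ γ) (hγ : γ ≤ 1 / 16)
    (T : Finset V) (hT : (T.card : ℝ) ≤ τ) :
    Real.exp (-(32 * (1 + Real.log τ) * γ)) ≤
      (shiftLaw V ((2 + 2 * Real.log τ) / Δ) Δ).real
        (⋃ t ∈ T, Cut w G N e (2 * (4 * γ * Δ)) z t)ᶜ := by
  have hlog := Real.log_nonneg hτ
  set r := (2 + 2 * Real.log τ) / Δ
  have hr : 0 < r := by positivity
  have hrΔ : r * Δ = 2 + 2 * Real.log τ := div_mul_cancel₀ _ hΔ.ne'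
  have := isProbabilityMeasure_shiftLaw (V := V) hr hΔ
  have hrs : r * (2 * (4 * γ * Δ)) = 16 * (1 + Real.log τ) * γ := by
    linear_combination (8 * γ) * hrΔ
  rw [probReal_compl_eq_one_sub (T.measurableSet_biUnion fun t _ => measurableSet_cut _ z t)]
  refine (exp_le_one_sub_of_rate hτ hγ0 hγ).trans (sub_le_sub_left ?_ 1)
  rw [← hrs, ← hrΔ]
  have hs : 0 ≤ 2 * (4 * γ * Δ) := by positivity
  have hc : 0 ≤ 1 - Real.exp (-(r * (2 * (4 * γ * Δ)))) := by
    rw [sub_nonneg, Real.exp_le_one_iff]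
    nlinarith [mul_nonneg hr.le hs]
  have hκ : 0 ≤ (Real.exp (r * Δ) - 1)⁻¹ :=
    inv_nonneg.2 (sub_nonneg.2 (Real.one_le_exp (mul_pos hr hΔ).le))
  calc _ ≤ ∑ t ∈ T, (shiftLaw V r Δ).real (Cut w G N e (2 * (4 * γ * Δ)) z t) :=
        measureReal_biUnion_finset_le _ _
    _ ≤ ∑ t ∈ T, (1 - Real.exp (-(r * (2 * (4 * γ * Δ))))) *
          ((shiftLaw V r Δ).real {δ | Wins w G N e δ z t} + (Real.exp (r * Δ) - 1)⁻¹) :=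
        Finset.sum_le_sum fun t _ => shiftLaw_cut_le hr hΔ hs z t
    _ ≤ _ := by
        rw [← Finset.mul_sum, Finset.sum_add_distrib, Finset.sum_const, nsmul_eq_mul]
        gcongr
        exact sum_shiftLaw_wins_le_one hr hΔ he z T

end Probability

end Pad

/-- A set of centers with covering radius `Δ` and at most `τ` centers in any
`3Δ`-ball yields a strongly `(32(1+ln τ), 1/16, 4Δ)`-padded decomposition. -/
theorem strongly_padded_decomposition_of_centers
    (V : Type) [Fintype V] (G : SimpleGraph V) (hG : G.Connected)
    (w : Sym2 V → ℝ) (hw : ∀ e, 0 ≤ w e)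
    (Δ τ : ℝ) (hΔ : 0 < Δ) (hτ : 1 ≤ τ)
    (N : Set V)
    (hcov : ∀ v : V, ∃ x ∈ N, Pad.wdist w G v x ≤ Δ)
    (hpack : ∀ v : V, (((Pad.ball w G v (3 * Δ) ∩ N).ncard : ℝ) ≤ τ)) :
    ∃ D : PMF (Pad.Partition V),
      (∀ P ∈ D.support, Pad.Partition.StronglyBounded w G P (4 * Δ)) ∧
      ∀ (z : V) (γ : ℝ), 0 ≤ γ → γ ≤ 1 / 16 →
        ENNReal.ofReal (Real.exp (-(32 * (1 + Real.log τ) * γ))) ≤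
          D.toOuterMeasure {P | Pad.ball w G z (4 * γ * Δ) ⊆ P.cl z} := by
  classical
  let _ : MeasurableSpace V := ⊤
  have hlog := Real.log_nonneg hτ
  set r := (2 + 2 * Real.log τ) / Δ
  have hr : 0 < r := by positivity
  have := Pad.isProbabilityMeasure_shiftLaw (V := V) hr hΔ
  obtain ⟨v₀⟩ := hG.nonempty
  have hN : N.Nonempty := let ⟨x, hx, _⟩ := hcov v₀; ⟨x, hx⟩
  obtain ⟨e, he⟩ := Countable.exists_injective_nat V
  choose c hc using fun (δ : V → ℝ) (v : V) =>
    Pad.exists_wins (w := w) (G := G) (e := e) (δ := δ) hN v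
  have hcm : Measurable c := by
    refine measurable_pi_iff.2 fun v => measurable_to_countable' fun t => ?_
    convert! Pad.measurableSet_wins (w := w) (G := G) (N := N) (e := e) v t using 1
    ext δ
    exact ⟨fun h => h ▸ hc δ v, fun h => (hc δ v).unique he h⟩
  have := Measure.isProbabilityMeasure_map (μ := Pad.shiftLaw V r Δ) hcm.aemeasurable
  refine ⟨((Pad.shiftLaw V r Δ).map c).toPMF.map Pad.Partition.ofFibres, fun P hP => ?_,
    fun z γ hγ0 hγ => ?_⟩
  · obtain ⟨g, hg, rfl⟩ := (PMF.mem_support_map_iff _ _ _).1 hP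
    rw [PMF.mem_support_iff, Measure.toPMF_apply,
      Measure.map_apply hcm (measurableSet_singleton g)] at hg
    obtain ⟨δ, hδg, hδ⟩ := ((frequently_ae_iff.2 hg).and_eventually
      (Pad.shiftLaw_ae_mem hr hΔ)).exists
    have hδg : c δ = g := hδg
    exact Pad.stronglyBounded_ofFibres hG hw hcov hδ he (hδg ▸ hc δ)
  · rw [PMF.toOuterMeasure_map_apply, ← PMF.toMeasure_apply_eq_toOuterMeasure,
      Measure.toPMF_toMeasure, Measure.map_apply hcm (Set.toFinite _).measurableSet]
    have hT := hpack z
    rw [Set.ncard_eq_toFinset_card'] at hT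
    refine (ENNReal.ofReal_le_ofReal (Pad.exp_le_shiftLaw_compl_cut (w := w) (G := G) (N := N)
      hΔ hτ he z hγ0 hγ _ hT)).trans ?_
    rw [ofReal_measureReal]
    refine measure_mono_ae ?_
    filter_upwards [Pad.shiftLaw_ae_mem hr hΔ] with δ hδ hcut
    refine Pad.ball_subset_of_notMem_cut hG hw he (hc δ) fun h => hcut ?_
    refine Set.mem_biUnion (x := c δ z) ?_ h
    have := (hc δ z).wdist_le hcov hδ
    simp only [SetLike.mem_coe, Set.mem_toFinset]
    exact ⟨show Pad.wdist w G z (c δ z) ≤ 3 * Δ by linarith, (hc δ z).1⟩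
end

section
/- There exist universal constants c > 0 and c' > 0 such that the following holds. Let G = (V, E, w) be a weighted graph whose underlying graph excludes the complete graph K_r as a minor (r ≥ 2). Then G admits a strong (c · r, c'/r)-padded decomposition scheme: for every Δ > 0 there is a probability distribution D over partitions of V such that every partition in the support of D is strongly Δ-bounded, and for every z ∈ V and every 0 ≤ γ ≤ c'/r, Pr_{P∼D}[B_G(z, γΔ) ⊆ P(z)] ≥ e^{-c·r·γ}. -/
open MeasureTheory

namespace Pad

section WalkIn

variable {V : Type*} {w : Sym2 V → ℝ} {G : SimpleGraph V} {C C' T : Set V} {u v x : V} {a b M : ℝ}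

/-- `WalkIn w G C u v a`: there is a walk of weight `a` from `u` to `v` all of whose vertices
lie in `C`. -/
inductive WalkIn (w : Sym2 V → ℝ) (G : SimpleGraph V) (C : Set V) : V → V → ℝ → Prop
  | nil {v : V} (h : v ∈ C) : WalkIn w G C v v 0
  | cons {u v x : V} {a : ℝ} (hu : u ∈ C) (h : G.Adj u v) (hp : WalkIn w G C v x a) :
      WalkIn w G C u x (w s(u, v) + a)

namespace WalkIn

theorem left_mem (h : WalkIn w G C u v a) : u ∈ C := by
  cases h <;> assumption

theorem right_mem (h : WalkIn w G C u v a) : v ∈ C := by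
  induction h <;> assumption

theorem nonneg (hw : ∀ e, 0 ≤ w e) (h : WalkIn w G C u v a) : 0 ≤ a := by
  induction h with
  | nil => exact le_rfl
  | cons _ _ _ ih => exact add_nonneg (hw _) ih

theorem mono (hC : C ⊆ C') (h : WalkIn w G C u v a) : WalkIn w G C' u v a := by
  induction h with
  | nil h => exact nil (hC h)
  | cons hu h _ ih => exact cons (hC hu) h ih

theorem trans (h : WalkIn w G C u v a) (h' : WalkIn w G C v x b) :
    WalkIn w G C u x (a + b) := by
  induction h with
  | nil => simpa using h'
  | cons hu h _ ih => rw [add_assoc]; exact cons hu h (ih h')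

theorem single (hu : u ∈ C) (hv : v ∈ C) (h : G.Adj u v) : WalkIn w G C u v (w s(u, v)) := by
  simpa using cons (w := w) hu h (nil hv)

theorem symm (h : WalkIn w G C u v a) : WalkIn w G C v u a := by
  induction h with
  | nil h => exact nil h
  | cons hu h hp ih =>
    rw [add_comm, Sym2.eq_swap]
    exact ih.trans (single hp.left_mem hu h.symm)

/-- A vertex property that propagates along the edges of a walk restricts the walk. -/
theorem restrict {P : V → Prop} (h : WalkIn w G C u v a) (hu : P u)
    (hP : ∀ x y, x ∈ C → y ∈ C → G.Adj x y → P x → P y) :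
    WalkIn w G {x | x ∈ C ∧ P x} u v a := by
  induction h with
  | nil h => exact nil ⟨h, hu⟩
  | cons hx h hp ih => exact cons ⟨hx, hu⟩ h (ih (hP _ _ hx hp.left_mem h hu))

theorem exists_walk (h : WalkIn w G C u v a) :
    ∃ p : G.Walk u v, (∀ x ∈ p.support, x ∈ C) ∧ walkWeight w p = a := by
  induction h with
  | nil h => exact ⟨.nil, by simpa using h, by simp [walkWeight]⟩
  | cons hu h _ ih =>
    obtain ⟨p, hp, hpa⟩ := ih
    refine ⟨.cons h p, ?_, ?_⟩
    · simpa [SimpleGraph.Walk.support_cons] using ⟨hu, hp⟩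
    · rw [← hpa]; simp [walkWeight]

theorem of_walk (p : G.Walk u v) (hp : ∀ x ∈ p.support, x ∈ C) :
    WalkIn w G C u v (walkWeight w p) := by
  induction p with
  | nil => simpa [walkWeight] using nil (w := w) (G := G) (hp _ (by simp))
  | cons h p ih =>
    have := cons (hp _ (by simp)) h (ih fun x hx => hp x (by simp [hx]))
    simpa [walkWeight] using this

theorem exists_induce_walk (h : WalkIn w G C u v a) :
    ∃ p : (G.induce C).Walk ⟨u, h.left_mem⟩ ⟨v, h.right_mem⟩, walkWeightI w p = a := by
  induction h with
  | nil h => exact ⟨.nil, by simp [walkWeightI]⟩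
  | cons hu h hp ih =>
    obtain ⟨p, hpa⟩ := ih
    have hadj : (G.induce C).Adj ⟨_, hu⟩ ⟨_, hp.left_mem⟩ := SimpleGraph.comap_adj.2 h
    refine ⟨.cons hadj p, ?_⟩
    simpa [walkWeightI] using hpa

/-- Every walk is at least as heavy as a walk without repeated edges. -/
theorem exists_edgeSet [Finite V] (hw : ∀ e, 0 ≤ w e) (h : WalkIn w G C u v a) :
    ∃ F : Finset (Sym2 V), WalkIn w G C u v (∑ e ∈ F, w e) ∧ ∑ e ∈ F, w e ≤ a := by
  classical
  obtain ⟨p, hp, rfl⟩ := h.exists_walk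
  have key : ∀ q : G.Walk u v, walkWeight w q = (q.edges.map w).sum := fun q => by
    simp [walkWeight, SimpleGraph.Walk.edges, List.map_map, Function.comp_def]
  have hnd : p.bypass.edges.Nodup := p.bypass_isPath.isTrail.edges_nodup
  have hs : ∑ e ∈ p.bypass.edges.toFinset, w e = walkWeight w p.bypass := by
    rw [key, List.sum_toFinset _ hnd]
  refine ⟨p.bypass.edges.toFinset, ?_, ?_⟩
  · rw [hs]
    exact of_walk _ fun x hx => hp x (p.support_bypass_subset_support hx)
  · rw [hs, key, key]
    obtain ⟨l, hl, hsub⟩ := List.subperm_of_subset hnd p.edges_bypass_subset_edges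
    rw [← (hl.map w).sum_eq]
    exact (hsub.map w).sum_le_sum fun x hx => by
      obtain ⟨e, -, rfl⟩ := List.mem_map.1 hx
      exact hw e

end WalkIn

/-- The distance from `v` to `T` inside `G[C]`, truncated at `M`. -/
noncomputable def distTo (w : Sym2 V → ℝ) (G : SimpleGraph V) (M : ℝ) (C T : Set V) (v : V) : ℝ :=
  sInf (insert M {a | ∃ x ∈ T, WalkIn w G C v x a})

theorem bddBelow_distTo (hw : ∀ e, 0 ≤ w e) :
    BddBelow (insert M {a | ∃ x ∈ T, WalkIn w G C v x a}) := by
  refine ⟨min M 0, ?_⟩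
  rintro a (rfl | ⟨x, -, h⟩)
  · exact min_le_left _ _
  · exact (min_le_right _ _).trans (h.nonneg hw)

theorem distTo_nonneg (hw : ∀ e, 0 ≤ w e) (hM : 0 ≤ M) : 0 ≤ distTo w G M C T v := by
  refine le_csInf (Set.insert_nonempty _ _) ?_
  rintro a (rfl | ⟨x, -, h⟩)
  · exact hM
  · exact h.nonneg hw

theorem distTo_le_cap (hw : ∀ e, 0 ≤ w e) : distTo w G M C T v ≤ M :=
  csInf_le (bddBelow_distTo hw) (Set.mem_insert _ _)

theorem distTo_le (hw : ∀ e, 0 ≤ w e) (hx : x ∈ T) (h : WalkIn w G C v x a) :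
    distTo w G M C T v ≤ a :=
  csInf_le (bddBelow_distTo hw) (Set.mem_insert_of_mem _ ⟨x, hx, h⟩)

theorem distTo_eq_cap_or [Finite V] (hw : ∀ e, 0 ≤ w e) :
    distTo w G M C T v = M ∨ ∃ x ∈ T, WalkIn w G C v x (distTo w G M C T v) := by
  set A : Set ℝ := insert M {a | ∃ x ∈ T, WalkIn w G C v x a}
  have hfin : (A ∩ insert M (Set.range fun F : Finset (Sym2 V) => ∑ e ∈ F, w e)).Finite :=
    ((Set.finite_range _).insert M).subset Set.inter_subset_right
  have hne : (A ∩ insert M (Set.range fun F : Finset (Sym2 V) => ∑ e ∈ F, w e)).Nonempty :=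
    ⟨M, Set.mem_insert _ _, Set.mem_insert _ _⟩
  have heq : sInf A = sInf (A ∩ insert M (Set.range fun F : Finset (Sym2 V) => ∑ e ∈ F, w e)) := by
    apply le_antisymm
    · exact csInf_le_csInf (bddBelow_distTo hw) hne Set.inter_subset_left
    · refine le_csInf (Set.insert_nonempty _ _) ?_
      rintro a (rfl | ⟨x, hx, h⟩)
      · exact csInf_le hfin.bddBelow ⟨Set.mem_insert _ _, Set.mem_insert _ _⟩
      · obtain ⟨F, hF, hFa⟩ := h.exists_edgeSet hw
        exact (csInf_le hfin.bddBelow ⟨Set.mem_insert_of_mem _ ⟨x, hx, hF⟩,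
          Set.mem_insert_of_mem _ ⟨F, rfl⟩⟩).trans hFa
  have hmem : distTo w G M C T v ∈ A := by
    have := (hne.csInf_mem hfin).1
    rwa [← heq] at this
  exact hmem

/-- A target that can be reached at all is reached at the distance, if the truncation is
large enough. -/
theorem exists_walkIn_distTo [Finite V] (hw : ∀ e, 0 ≤ w e)
    (hM : ∀ F : Finset (Sym2 V), ∑ e ∈ F, w e < M) (hx : x ∈ T) (h : WalkIn w G C v x a) :
    ∃ y ∈ T, WalkIn w G C v y (distTo w G M C T v) := by
  obtain ⟨F, hF, -⟩ := h.exists_edgeSet hw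
  rcases distTo_eq_cap_or (G := G) (M := M) (C := C) (T := T) (v := v) hw with h' | h'
  · exact absurd (distTo_le (M := M) hw hx hF) (by rw [h']; exact not_le.2 (hM F))
  · exact h'

theorem distTo_le_add [Finite V] (hw : ∀ e, 0 ≤ w e) (h : WalkIn w G C u v a) :
    distTo w G M C T u ≤ a + distTo w G M C T v := by
  rcases distTo_eq_cap_or (G := G) (M := M) (C := C) (T := T) (v := v) hw with h' | ⟨x, hx, h'⟩
  · rw [h']
    have := distTo_le_cap (G := G) (M := M) (C := C) (T := T) (v := u) hw
    linarith [h.nonneg hw]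
  · exact distTo_le hw hx (h.trans h')

theorem distTo_eq_zero (hw : ∀ e, 0 ≤ w e) (hM : 0 ≤ M) (hv : v ∈ C) (hT : v ∈ T) :
    distTo w G M C T v = 0 :=
  le_antisymm (distTo_le hw hT (.nil hv)) (distTo_nonneg hw hM)

/-- A vertex property that propagates along the edges of a geodesic restricts the geodesic. -/
theorem WalkIn.restrict_geodesic [Finite V] (hw : ∀ e, 0 ≤ w e) {P : V → Prop} (hx : x ∈ T)
    (h : WalkIn w G C v x a) (ha : a = distTo w G M C T v) (hv : P v)
    (hP : ∀ y z, y ∈ C → z ∈ C → G.Adj y z →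
      distTo w G M C T y = w s(y, z) + distTo w G M C T z → P y → P z) :
    WalkIn w G {y | y ∈ C ∧ P y} v x a := by
  induction h with
  | nil h => exact .nil ⟨h, hv⟩
  | @cons y z x b hy hadj hp ih =>
    have h1 : distTo w G M C T z ≤ b := distTo_le hw hx hp
    have h2 := distTo_le_add (M := M) (T := T) hw (WalkIn.single (w := w) hy hp.left_mem hadj)
    have h3 : b = distTo w G M C T z := by linarith
    exact .cons ⟨hy, hv⟩ hadj (ih hx h3 (hP _ _ hy hp.left_mem hadj (by rw [← ha, h3]) hv))

/-- The vertex set of a geodesic. -/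
theorem WalkIn.exists_segment [Finite V] (hw : ∀ e, 0 ≤ w e) (hx : x ∈ T)
    (h : WalkIn w G C v x a) (ha : a = distTo w G M C T v) :
    ∃ P ⊆ C, v ∈ P ∧ x ∈ P ∧ (∀ u ∈ P, distTo w G M C T u ≤ distTo w G M C T v) ∧
      ∀ u ∈ P, ∀ u' ∈ P, WalkIn w G P u u' |distTo w G M C T u - distTo w G M C T u'| := by
  induction h with
  | @nil v h =>
    refine ⟨{v}, by simpa using h, rfl, rfl, ?_, ?_⟩
    · rintro u rfl; exact le_rfl
    · rintro u rfl u' rfl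
      simpa using WalkIn.nil (w := w) (G := G) (Set.mem_singleton _)
  | @cons y z x b hy hadj hp ih =>
    have h1 : distTo w G M C T z ≤ b := distTo_le hw hx hp
    have h2 := distTo_le_add (M := M) (T := T) hw (WalkIn.single (w := w) hy hp.left_mem hadj)
    have h3 : b = distTo w G M C T z := by linarith
    obtain ⟨P, hPC, hzP, hxP, hle, hP⟩ := ih hx h3
    have h4 : distTo w G M C T y = w s(y, z) + distTo w G M C T z := by rw [← ha, h3]
    have h5 := hw s(y, z)
    have key : ∀ u ∈ P, WalkIn w G (insert y P) y u
        |distTo w G M C T y - distTo w G M C T u| := by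
      intro u hu
      have h6 := hle u hu
      have := WalkIn.cons (w := w) (Set.mem_insert y P) hadj
        ((hP z hzP u hu).mono (Set.subset_insert y P))
      rw [abs_of_nonneg (by linarith)] at this ⊢
      convert this using 1
      rw [h4]; ring
    refine ⟨insert y P, Set.insert_subset hy hPC, Set.mem_insert _ _,
      Set.mem_insert_of_mem _ hxP, ?_, ?_⟩
    · rintro u (rfl | hu)
      · exact le_rfl
      · linarith [hle u hu]
    · rintro u (rfl | hu) u' (rfl | hu')
      · simpa using WalkIn.nil (w := w) (G := G) (Set.mem_insert _ P)
      · exact key u' hu'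
      · rw [abs_sub_comm]; exact (key u hu).symm
      · exact (hP u hu u' hu').mono (Set.subset_insert y P)

end WalkIn

section Weights

open Finset

/-- Finitely many prescribed values occur in a monotone sequence going from `0` to `l`. -/
theorem exists_breakpoints (s : Finset ℝ) (hs : ∀ x ∈ s, 0 ≤ x) {l : ℝ} (hl : 0 ≤ l) :
    ∃ (n : ℕ) (a : ℕ → ℝ), Monotone a ∧ a 0 = 0 ∧ a n = l ∧ (∀ i, a i ≤ l) ∧
      ∀ x ∈ s, x ≤ l → ∃ j ≤ n, a j = x := by
  set t : Finset ℝ := insert 0 (insert l (s.filter (· ≤ l))) with ht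
  have ht0 : ∀ x ∈ t, 0 ≤ x := by
    intro x hx
    simp only [ht, mem_insert, mem_filter] at hx
    rcases hx with rfl | rfl | hx
    exacts [le_rfl, hl, hs x hx.1]
  have htl : ∀ x ∈ t, x ≤ l := by
    intro x hx
    simp only [ht, mem_insert, mem_filter] at hx
    rcases hx with rfl | rfl | hx
    exacts [hl, le_rfl, hx.2]
  have hmem : ∀ x ∈ t, ∃ i, t.orderEmbOfFin rfl i = x := by
    intro x hx
    have : x ∈ Set.range (t.orderEmbOfFin rfl) := by simpa using hx
    exact this
  have hpos : 0 < #t := card_pos.2 ⟨0, by simp [ht]⟩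
  let a : ℕ → ℝ := fun i => if h : i < #t then t.orderEmbOfFin rfl ⟨i, h⟩ else l
  have hmono : Monotone a := by
    intro i j hij
    by_cases hj : j < #t
    · have hi : i < #t := hij.trans_lt hj
      simpa [a, hi, hj] using hij
    · by_cases hi : i < #t
      · simpa [a, hi, hj] using htl _ (t.orderEmbOfFin_mem rfl ⟨i, hi⟩)
      · simp [a, hi, hj]
  have hval : ∀ x ∈ t, ∃ j ≤ #t - 1, a j = x := by
    intro x hx
    obtain ⟨i, rfl⟩ := hmem x hx
    exact ⟨i, by omega, by simp [a]⟩
  refine ⟨#t - 1, a, hmono, ?_, ?_, fun i => ?_, fun x hx hxl => hval x (by simp [ht, hx, hxl])⟩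
  · obtain ⟨j, -, hj⟩ := hval 0 (by simp [ht])
    refine le_antisymm (hj ▸ hmono (Nat.zero_le j)) ?_
    simpa [a, hpos] using ht0 _ (t.orderEmbOfFin_mem rfl ⟨0, hpos⟩)
  · obtain ⟨j, hj', hj⟩ := hval l (by simp [ht])
    refine le_antisymm ?_ (hj ▸ hmono hj')
    have : #t - 1 < #t := by omega
    simpa [a, this] using htl _ (t.orderEmbOfFin_mem rfl ⟨#t - 1, this⟩)
  · by_cases hi : i < #t
    · simpa [a, hi] using htl _ (t.orderEmbOfFin_mem rfl ⟨i, hi⟩)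
    · simp [a, hi]

/-- The unnormalized probability that a truncated exponential threshold falls between `a i`
and `a (i + 1)`. -/
noncomputable def gap (a : ℕ → ℝ) (i : ℕ) : ℝ :=
  Real.exp (-a i) - Real.exp (-a (i + 1))

theorem gap_nonneg {a : ℕ → ℝ} (ha : Monotone a) (i : ℕ) : 0 ≤ gap a i := by
  have := ha (Nat.le_succ i)
  exact sub_nonneg.2 (Real.exp_le_exp.2 (by simpa using this))

theorem sum_gap (a : ℕ → ℝ) (n : ℕ) :
    ∑ i ∈ range n, gap a i = Real.exp (-a 0) - Real.exp (-a n) :=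
  sum_range_sub' (fun i => Real.exp (-a i)) n

/-- The padding inequality for one truncated exponential threshold. The ball has values in
`[sm, sp]`; it is avoided while `a i < sm` and captured when `sp ≤ a i`. -/
theorem le_sum_gap_mul {n : ℕ} {a x f : ℕ → ℝ} {l D sm sp θ φ ε : ℝ} (ha : Monotone a)
    (h0 : a 0 = 0) (hn : a n = l) (hε : ε * (1 - Real.exp (-l)) = Real.exp (-l)) (hθ : 0 ≤ θ)
    (hε0 : 0 ≤ ε) (hD : 0 ≤ D)
    (hle : sm ≤ sp) (hsp : sp ≤ sm + D)
    (hsm_val : sm ≤ l → ∃ j ≤ n, a j = sm) (hsp_val : sp ≤ l → ∃ j ≤ n, a j = sp)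
    (hx1 : ∀ i < n, a i < sm →
      θ * (Real.exp (-D) - (1 - Real.exp (-D)) * ε * f i) ≤ x i)
    (hx2 : ∀ i < n, sp ≤ a i → θ ≤ x i) (hx0 : ∀ i < n, 0 ≤ x i)
    (h1 : ∀ j ≤ n, a j = sm → ∑ i ∈ range j, gap a i * f i + (1 - Real.exp (-l)) ≤
      (1 - Real.exp (-l)) * φ)
    (h2 : l < sm → ∑ i ∈ range n, gap a i * f i ≤ (1 - Real.exp (-l)) * φ) :
    (1 - Real.exp (-l)) * (θ * (Real.exp (-D) - (1 - Real.exp (-D)) * ε * φ)) ≤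
      ∑ i ∈ range n, gap a i * x i := by
  set b := Real.exp (-D) with hb
  have hb1 : b ≤ 1 := Real.exp_le_one_iff.2 (by linarith)
  have hcoef : 0 ≤ θ * ((1 - b) * ε) := mul_nonneg hθ (mul_nonneg (by linarith) hε0)
  have hpart : ∀ j ≤ n, (∀ i < j, a i < sm ∨ gap a i = 0) →
      θ * (b * (1 - Real.exp (-a j))) - θ * ((1 - b) * ε) * ∑ i ∈ range j, gap a i * f i ≤
        ∑ i ∈ range j, gap a i * x i := by
    intro j hj hi
    have : ∑ i ∈ range j, gap a i * (θ * (b - (1 - b) * ε * f i)) ≤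
        ∑ i ∈ range j, gap a i * x i := by
      refine sum_le_sum fun i hij => ?_
      have hij := mem_range.1 hij
      rcases hi i hij with h | h
      · exact mul_le_mul_of_nonneg_left (hx1 i (hij.trans_le hj) h) (gap_nonneg ha i)
      · simp [h]
    refine le_trans (le_of_eq ?_) this
    have hs := sum_gap a j
    rw [h0, neg_zero, Real.exp_zero] at hs
    rw [← hs, mul_sum, mul_sum, mul_sum, ← sum_sub_distrib]
    exact sum_congr rfl fun i _ => by ring
  rcases lt_or_ge l sm with hl | hl
  · have h3 := hpart n le_rfl fun i hi => .inl ((ha hi.le).trans_lt (hn ▸ hl))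
    have h4 := mul_le_mul_of_nonneg_left (h2 hl) hcoef
    rw [hn] at h3
    linarith
  · obtain ⟨j, hjn, hj⟩ := hsm_val hl
    have h3 := hpart j hjn fun i hi => by
      rcases (ha hi.le).lt_or_eq with h | h
      · exact .inl (hj ▸ h)
      · right
        have h5 : a (i + 1) = a i := le_antisymm (h ▸ ha hi) (ha (Nat.le_succ i))
        simp [gap, h5]
    have h4 := mul_le_mul_of_nonneg_left (h1 j hjn hj) hcoef
    have hsplit : ∀ k, j ≤ k → k ≤ n →
        ∑ i ∈ range j, gap a i * x i + ∑ i ∈ Ico k n, gap a i * x i ≤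
          ∑ i ∈ range n, gap a i * x i := by
      intro k hjk hkn
      rw [range_eq_Ico, range_eq_Ico, ← sum_Ico_consecutive _ (Nat.zero_le j) hjn,
        ← sum_Ico_consecutive _ hjk hkn]
      have : 0 ≤ ∑ i ∈ Ico j k, gap a i * x i := sum_nonneg fun i hi =>
        mul_nonneg (gap_nonneg ha i) (hx0 i ((mem_Ico.1 hi).2.trans_le hkn))
      linarith
    have hκ : ∀ t, t ≤ sm + D → b * Real.exp (-sm) ≤ Real.exp (-t) := by
      intro t ht
      rw [hb, ← Real.exp_add]
      exact Real.exp_le_exp.2 (by linarith)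
    have hmain : ∀ t, t ≤ sm + D → ∑ i ∈ range j, gap a i * x i +
        θ * (Real.exp (-t) - Real.exp (-l)) ≤ ∑ i ∈ range n, gap a i * x i →
        (1 - Real.exp (-l)) * (θ * (b - (1 - b) * ε * φ)) ≤ ∑ i ∈ range n, gap a i * x i := by
      intro t ht hS
      have h6 := mul_le_mul_of_nonneg_left (hκ t ht) hθ
      rw [hj] at h3
      have h7 : θ * ((1 - b) * ε) * (1 - Real.exp (-l)) = θ * (1 - b) * Real.exp (-l) := by
        linear_combination θ * (1 - b) * hε
      linarith
    rcases lt_or_ge l sp with hl' | hl'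
    · refine hmain l (by linarith) ?_
      have := hsplit n hjn le_rfl
      simpa using this
    · obtain ⟨k, hkn, hk⟩ := hsp_val hl'
      refine hmain sp hsp ?_
      rcases le_total j k with hjk | hkj
      · refine le_trans (add_le_add le_rfl ?_) (hsplit k hjk hkn)
        have : ∑ i ∈ Ico k n, gap a i * θ ≤ ∑ i ∈ Ico k n, gap a i * x i :=
          sum_le_sum fun i hi => mul_le_mul_of_nonneg_left
            (hx2 i (mem_Ico.1 hi).2 (hk ▸ ha (mem_Ico.1 hi).1)) (gap_nonneg ha i)
        refine le_trans (le_of_eq ?_) this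
        rw [← sum_mul, sum_Ico_eq_sub _ hkn, sum_gap, sum_gap, hk, hn]
        ring
      · have hsms : sm = sp := le_antisymm hle (hj ▸ hk ▸ ha hkj)
        refine le_trans (add_le_add le_rfl ?_) (hsplit j le_rfl hjn)
        have : ∑ i ∈ Ico j n, gap a i * θ ≤ ∑ i ∈ Ico j n, gap a i * x i :=
          sum_le_sum fun i hi => mul_le_mul_of_nonneg_left
            (hx2 i (mem_Ico.1 hi).2 (hsms ▸ hj ▸ ha (mem_Ico.1 hi).1)) (gap_nonneg ha i)
        refine le_trans (le_of_eq ?_) this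
        rw [← sum_mul, sum_Ico_eq_sub _ hjn, sum_gap, sum_gap, hj, hn, hsms]
        ring

/-- Geometrically discounted sum of a list. -/
noncomputable def discount : List ℝ → ℝ
  | [] => 0
  | y :: l => (y + discount l) / 2

/-- Geometrically discounted sum of a list whose entries are raised to at least `m`, and which
is continued by `m` forever. -/
noncomputable def discountFrom (m : ℝ) : List ℝ → ℝ
  | [] => m
  | y :: l => (max y m + discountFrom m l) / 2

theorem discountFrom_le_one {m : ℝ} (hm : m ≤ 1) {l : List ℝ} (h : ∀ y ∈ l, y ≤ 1) :
    discountFrom m l ≤ 1 := by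
  induction l with
  | nil => simpa [discountFrom]
  | cons y l ih =>
    have := ih fun y hy => h y (by simp [hy])
    have := max_le (h y (by simp)) hm
    simp only [discountFrom]; linarith

theorem discountFrom_le {m : ℝ} (hm : 0 ≤ m) {l : List ℝ} (h : ∀ y ∈ l, 0 ≤ y) :
    discountFrom m l ≤ discount l + m := by
  induction l with
  | nil => simp [discountFrom, discount]
  | cons y l ih =>
    have := ih fun y hy => h y (by simp [hy])
    have h0 := h y (by simp)
    have : max y m ≤ y + m := max_le (by linarith) (by linarith)
    simp only [discountFrom, discount]; linarith

theorem le_discountFrom (m : ℝ) (l : List ℝ) :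
    discount l + (1 / 2) ^ l.length * m ≤ discountFrom m l := by
  induction l with
  | nil => simp [discountFrom, discount]
  | cons y l ih =>
    have := le_max_left y m
    simp only [discountFrom, discount, List.length_cons, pow_succ]; linarith

theorem discountFrom_eq {m : ℝ} {l : List ℝ} (h : ∀ y ∈ l, y ≤ m) : discountFrom m l = m := by
  induction l with
  | nil => rfl
  | cons y l ih =>
    rw [discountFrom, ih fun y hy => h y (by simp [hy]), max_eq_right (h y (by simp))]
    ring

theorem discountFrom_le_combine {m q : ℝ} (hm : 0 ≤ m) (hq : 0 < q) (hq1 : q ≤ 1) {l : List ℝ}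
    (hl : l.Pairwise (fun x y => y ≤ x)) :
    discountFrom m l ≤ (1 - q ^ 2) * discount (l.takeWhile (fun y => m < y) ++ [m / q]) +
      q ^ 2 * discountFrom (m / q) l := by
  have hmq : m ≤ m / q := by rw [le_div_iff₀ hq]; nlinarith
  have key : m ≤ (1 - q ^ 2) * (m / q / 2) + q ^ 2 * (m / q) := by
    have : (1 - q ^ 2) * (m / q / 2) + q ^ 2 * (m / q) - m = (m / q) * (1 - q) ^ 2 / 2 := by
      field_simp; ring
    have : 0 ≤ (m / q) * (1 - q) ^ 2 / 2 := by positivity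
    linarith
  induction l with
  | nil => simpa [discountFrom, discount] using key
  | cons y l ih =>
    rw [List.pairwise_cons] at hl
    rcases lt_or_ge m y with h | h
    · have := ih hl.2
      simp only [h, decide_true, List.takeWhile_cons_of_pos, List.cons_append, discountFrom,
        discount, max_eq_left h.le]
      have h1 := mul_le_mul_of_nonneg_left (le_max_left y (m / q)) (sq_nonneg q)
      linarith
    · have hall : ∀ x ∈ y :: l, x ≤ m := by
        intro x hx
        rcases List.mem_cons.1 hx with rfl | hx
        exacts [h, (hl.1 x hx).trans h]
      rw [discountFrom_eq hall, discountFrom_eq fun x hx => (hall x hx).trans hmq,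
        List.takeWhile_cons_of_neg (by simpa using h)]
      simpa [discount] using key

theorem discount_le_orderedInsert {α : Type*} (f : α → ℝ) (x : α) (l : List α) :
    discount (f x :: l.map f) ≤ discount ((l.orderedInsert (fun p q => f q ≤ f p) x).map f) := by
  induction l with
  | nil => simp
  | cons y l ih =>
    by_cases h : f y ≤ f x
    · simp [List.orderedInsert, h]
    · rw [List.orderedInsert, if_neg h]
      simp only [List.map_cons, discount] at ih ⊢
      linarith

theorem exists_perm_sorted {α : Type*} (f : α → ℝ) (l : List α) :
    ∃ l' : List α, l'.Perm l ∧ (l'.map f).Pairwise (fun x y => y ≤ x) ∧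
      discount (l.map f) ≤ discount (l'.map f) := by
  have htot : Std.Total (fun p q : α => f q ≤ f p) := ⟨fun p q => le_total _ _⟩
  have htr : IsTrans α (fun p q : α => f q ≤ f p) := ⟨fun p q s h h' => h'.trans h⟩
  refine ⟨l.insertionSort (fun p q => f q ≤ f p), List.perm_insertionSort _ _, ?_, ?_⟩
  · rw [List.pairwise_map]
    exact List.pairwise_insertionSort _ _
  · induction l with
    | nil => simp
    | cons x l ih =>
      refine le_trans ?_ (discount_le_orderedInsert f x _)
      exact div_le_div_of_nonneg_right (add_le_add le_rfl ih) zero_le_two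

theorem discountFrom_le_sum_gap {a : ℕ → ℝ} (ha : Monotone a) (h0 : a 0 = 0) (g : ℝ) {l : List ℝ}
    (hl : l.Pairwise (fun x y => y ≤ x)) (n : ℕ) :
    discountFrom (Real.exp (-(g - a 0) / 2)) l ≤
      ∑ i ∈ range n, gap a i * discount (l.takeWhile (fun y => Real.exp (-(g - a i) / 2) < y) ++
        [Real.exp (-(g - a (i + 1)) / 2)]) +
      Real.exp (-a n) * discountFrom (Real.exp (-(g - a n) / 2)) l := by
  induction n with
  | zero => simp [h0]
  | succ n ih =>
    have h1 := discountFrom_le_combine (m := Real.exp (-(g - a n) / 2))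
      (q := Real.exp (-(a (n + 1) - a n) / 2)) (Real.exp_nonneg _) (Real.exp_pos _)
      (Real.exp_le_one_iff.2 (by linarith [ha (Nat.le_succ n)])) hl
    have h2 : Real.exp (-(g - a n) / 2) / Real.exp (-(a (n + 1) - a n) / 2) =
        Real.exp (-(g - a (n + 1)) / 2) := by
      rw [← Real.exp_sub]; congr 1; ring
    have h3 : Real.exp (-a n) * Real.exp (-(a (n + 1) - a n) / 2) ^ 2 = Real.exp (-a (n + 1)) := by
      rw [← Real.exp_nat_mul, ← Real.exp_add]; congr 1; push_cast; ring
    rw [h2] at h1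
    have h4 := mul_le_mul_of_nonneg_left h1 (Real.exp_nonneg (-a n))
    rw [mul_add, ← mul_assoc, ← mul_assoc, mul_sub, h3, mul_one] at h4
    rw [sum_range_succ, gap]
    linarith

/-- The potential drops, up to normalization, by what the threatened ball needs. -/
theorem sum_gap_mul_le_of_le {a : ℕ → ℝ} (ha : Monotone a) (h0 : a 0 = 0) {g : ℝ} {l : List ℝ}
    (hl : l.Pairwise (fun x y => y ≤ x)) (h1 : ∀ y ∈ l, y ≤ 1) {j : ℕ} (hj : a j ≤ g) :
    ∑ i ∈ range j, gap a i * (1 - discount (l.takeWhile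
        (fun y => Real.exp (-(g - a i) / 2) < y) ++ [Real.exp (-(g - a (i + 1)) / 2)])) ≤
      1 - discount l - (1 / 2) ^ l.length * Real.exp (-g / 2) := by
  have hs := sum_gap a j
  have hd := discountFrom_le_sum_gap ha h0 g hl j
  have h2 := le_discountFrom (Real.exp (-(g - a 0) / 2)) l
  have h3 : discountFrom (Real.exp (-(g - a j) / 2)) l ≤ 1 :=
    discountFrom_le_one (Real.exp_le_one_iff.2 (by linarith)) h1
  have h4 := mul_le_mul_of_nonneg_left h3 (Real.exp_nonneg (-a j))
  simp only [mul_sub, mul_one, sum_sub_distrib]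
  rw [h0] at hs hd h2
  rw [sub_zero] at hd h2
  rw [neg_zero, Real.exp_zero] at hs
  linarith

theorem sum_gap_mul_le {a : ℕ → ℝ} (ha : Monotone a) (h0 : a 0 = 0) {g : ℝ} {l : List ℝ}
    (hl : l.Pairwise (fun x y => y ≤ x)) (h1 : ∀ y ∈ l, 0 ≤ y) {n : ℕ}
    (hn : Real.exp (-a n / 2) ≤ (1 / 2) ^ l.length) :
    ∑ i ∈ range n, gap a i * (1 - discount (l.takeWhile
        (fun y => Real.exp (-(g - a i) / 2) < y) ++ [Real.exp (-(g - a (i + 1)) / 2)])) ≤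
      (1 - Real.exp (-a n)) * (1 - discount l) := by
  have hs := sum_gap a n
  have hd := discountFrom_le_sum_gap ha h0 g hl n
  have h2 := le_discountFrom (Real.exp (-(g - a 0) / 2)) l
  have h3 := discountFrom_le (Real.exp_nonneg (-(g - a n) / 2)) h1
  have h4 := mul_le_mul_of_nonneg_left h3 (Real.exp_nonneg (-a n))
  have h5 : Real.exp (-a n) * Real.exp (-(g - a n) / 2) =
      Real.exp (-a n / 2) * Real.exp (-g / 2) := by
    rw [← Real.exp_add, ← Real.exp_add]; congr 1; ring
  have h6 := mul_le_mul_of_nonneg_right hn (Real.exp_nonneg (-g / 2))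
  simp only [mul_sub, mul_one, sum_sub_distrib]
  rw [h0] at hs hd h2
  rw [sub_zero] at hd h2
  rw [neg_zero, Real.exp_zero] at hs
  linarith

end Weights

section RandPart

variable {V : Type*} {w : Sym2 V → ℝ} {G : SimpleGraph V} {A S : Set V} {L : ℝ}

/-- `x` assigns to every vertex of `A` its cluster in a partition of `A` into clusters of strong
diameter at most `L`. -/
structure IsPart (w : Sym2 V → ℝ) (G : SimpleGraph V) (A : Set V) (L : ℝ) (x : V → Set V) :
    Prop where
  mem : ∀ v ∈ A, v ∈ x v
  subset : ∀ v ∈ A, x v ⊆ A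
  eq : ∀ v ∈ A, ∀ u ∈ x v, x u = x v
  diam : ∀ v ∈ A, ∀ u ∈ x v, ∀ u' ∈ x v, ∃ a ≤ L, WalkIn w G (x v) u u' a

open Classical in
theorem IsPart.glue {x y : V → Set V} (hx : IsPart w G S L x) (hy : IsPart w G (A \ S) L y)
    (hS : S ⊆ A) : IsPart w G A L (fun v => if v ∈ S then x v else y v) where
  mem v hv := by
    by_cases h : v ∈ S
    · simpa [h] using hx.mem v h
    · simpa [h] using hy.mem v ⟨hv, h⟩
  subset v hv := by
    by_cases h : v ∈ S
    · simpa [h] using (hx.subset v h).trans hS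
    · simpa [h] using (hy.subset v ⟨hv, h⟩).trans Set.sdiff_subset
  eq v hv u hu := by
    by_cases h : v ∈ S
    · simp only [h, if_true] at hu ⊢
      simpa [hx.subset v h hu] using hx.eq v h u hu
    · simp only [h, if_false] at hu ⊢
      simpa [(hy.subset v ⟨hv, h⟩ hu).2] using hy.eq v ⟨hv, h⟩ u hu
  diam v hv := by
    by_cases h : v ∈ S
    · simpa [h] using hx.diam v h
    · simpa [h] using hy.diam v ⟨hv, h⟩

/-- A finitely supported random partition of `A` into clusters of strong diameter at most `L`. -/
structure RandPart (w : Sym2 V → ℝ) (G : SimpleGraph V) (A : Set V) (L : ℝ) where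
  ι : Type
  [fintype : Fintype ι]
  p : ι → ℝ
  x : ι → V → Set V
  nonneg : ∀ i, 0 ≤ p i
  sum_eq : ∑ i, p i = 1
  isPart : ∀ i, IsPart w G A L (x i)

namespace RandPart

attribute [instance] RandPart.fintype

open Classical in
/-- The probability that `B` is contained in the cluster of `z`. -/
noncomputable def prob (μ : RandPart w G A L) (z : V) (B : Set V) : ℝ :=
  ∑ i, if B ⊆ μ.x i z then μ.p i else 0

theorem prob_nonneg (μ : RandPart w G A L) (z : V) (B : Set V) : 0 ≤ μ.prob z B :=
  Finset.sum_nonneg fun i _ => by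
    split_ifs
    exacts [μ.nonneg i, le_rfl]

/-- The partition of `A` with a single cluster. -/
def single (h : ∀ u ∈ A, ∀ v ∈ A, ∃ a ≤ L, WalkIn w G A u v a) : RandPart w G A L where
  ι := Unit
  p _ := 1
  x _ _ := A
  nonneg _ := zero_le_one
  sum_eq := by simp
  isPart _ := ⟨fun _ h => h, fun _ _ => subset_rfl, fun _ _ _ _ => rfl, fun _ _ => h⟩

theorem prob_single (h : ∀ u ∈ A, ∀ v ∈ A, ∃ a ≤ L, WalkIn w G A u v a) (z : V) {B : Set V}
    (hB : B ⊆ A) : (single h).prob z B = 1 := by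
  exact (Finset.sum_congr rfl fun i _ => if_pos hB).trans (single h).sum_eq

open Classical in
/-- Choose `i < n` with probability proportional to `p i`, and then partition `S i` and `A \ S i`
independently. -/
theorem exists_combine {n : ℕ} {p : ℕ → ℝ} {Z : ℝ} (hp : ∀ i, 0 ≤ p i) (hZ : 0 < Z)
    (hsum : ∑ i ∈ Finset.range n, p i = Z) {S : ℕ → Set V} (hS : ∀ i, S i ⊆ A)
    (μ : ∀ i, RandPart w G (S i) L) (ν : ∀ i, RandPart w G (A \ S i) L) :
    ∃ κ : RandPart w G A L, ∀ z B, ∑ i ∈ Finset.range n,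
      p i * (if z ∈ S i then (μ i).prob z B else (ν i).prob z B) = Z * κ.prob z B := by
  refine ⟨⟨Σ i : Fin n, (μ i).ι × (ν i).ι, fun s => p s.1 / Z * ((μ s.1).p s.2.1 * (ν s.1).p s.2.2),
    fun s v => if v ∈ S s.1 then (μ s.1).x s.2.1 v else (ν s.1).x s.2.2 v, ?_, ?_, ?_⟩, ?_⟩
  · exact fun s => mul_nonneg (div_nonneg (hp _) hZ.le)
      (mul_nonneg ((μ _).nonneg _) ((ν _).nonneg _))
  · rw [Fintype.sum_sigma]
    simp only [Fintype.sum_prod_type, ← Finset.mul_sum, (μ _).sum_eq, (ν _).sum_eq, mul_one]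
    rw [Fin.sum_univ_eq_sum_range (fun i => p i / Z), ← Finset.sum_div, hsum, div_self hZ.ne']
  · exact fun s => ((μ s.1).isPart s.2.1).glue ((ν s.1).isPart s.2.2) (hS _)
  · intro z B
    rw [prob, Fintype.sum_sigma, Finset.mul_sum,
      ← Fin.sum_univ_eq_sum_range (fun i => p i *
        (if z ∈ S i then (μ i).prob z B else (ν i).prob z B))]
    refine Finset.sum_congr rfl fun i _ => ?_
    rw [Fintype.sum_prod_type]
    by_cases h : z ∈ S i
    · have : ∀ s, (∑ t, if B ⊆ (μ i).x s z then p i / Z * ((μ i).p s * (ν i).p t) else 0) =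
          p i / Z * (if B ⊆ (μ i).x s z then (μ i).p s else 0) := by
        intro s
        split_ifs
        · rw [← Finset.mul_sum, ← Finset.mul_sum, (ν i).sum_eq, mul_one]
        · simp
      simp only [h, if_true, this, ← Finset.mul_sum, prob]
      field_simp
    · have : ∀ t, (∑ s, if B ⊆ (ν i).x t z then p i / Z * ((μ i).p s * (ν i).p t) else 0) =
          p i / Z * (if B ⊆ (ν i).x t z then (ν i).p t else 0) := by
        intro t
        split_ifs
        · rw [← Finset.mul_sum, ← Finset.sum_mul, (μ i).sum_eq, one_mul]
        · simp
      rw [Finset.sum_comm]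
      simp only [h, if_false, this, ← Finset.mul_sum, prob]
      field_simp

end RandPart

/-- `B` is contained in the ball of radius `γ` around `z` inside `G[B]`. -/
def IsStar (w : Sym2 V → ℝ) (G : SimpleGraph V) (z : V) (B : Set V) (γ : ℝ) : Prop :=
  z ∈ B ∧ ∀ u ∈ B, ∃ a ≤ γ, WalkIn w G B u z a

/-- A Lipschitz function of a small set has small oscillation. -/
theorem IsStar.exists_extrema [Finite V] {z : V} {B : Set V} {γ K : ℝ} (hB : IsStar w G z B γ)
    (hK : 0 ≤ K) {g : V → ℝ}
    (hg : ∀ u ∈ B, ∀ v ∈ B, ∀ a, WalkIn w G B u v a → g u ≤ K * a + g v) :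
    ∃ s ∈ B, ∃ t ∈ B, (∀ u ∈ B, g s ≤ g u) ∧ (∀ u ∈ B, g u ≤ g t) ∧
      g t ≤ g s + K * (2 * γ) ∧ g z ≤ g s + K * γ := by
  have hfin : B.Finite := Set.toFinite B
  obtain ⟨s, hs, hsm⟩ := Set.exists_min_image B g hfin ⟨z, hB.1⟩
  obtain ⟨t, ht, htm⟩ := Set.exists_max_image B g hfin ⟨z, hB.1⟩
  refine ⟨s, hs, t, ht, hsm, htm, ?_, ?_⟩
  · obtain ⟨a, ha, h1⟩ := hB.2 t ht
    obtain ⟨b, hb, h2⟩ := hB.2 s hs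
    have h3 := hg t ht z hB.1 a h1
    have h4 := hg z hB.1 s hs b h2.symm
    have := mul_le_mul_of_nonneg_left ha hK
    have := mul_le_mul_of_nonneg_left hb hK
    linarith
  · obtain ⟨b, hb, h2⟩ := hB.2 s hs
    have h4 := hg z hB.1 s hs b h2.symm
    have := mul_le_mul_of_nonneg_left hb hK
    linarith

end RandPart

section Threshold

variable {V : Type*} {w : Sym2 V → ℝ} {G : SimpleGraph V} {A : Set V} {L l M ε ρ : ℝ}

open Finset in
/-- Cutting out a random sublevel set of `g` with a truncated exponential threshold. -/
theorem exists_threshold [Finite V] (hl : 0 < l)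
    (hε : ε * (1 - Real.exp (-l)) = Real.exp (-l)) (hε0 : 0 ≤ ε) (A : Set V) {g : V → ℝ}
    (hg0 : ∀ v, 0 ≤ g v) :
    ∃ (n : ℕ) (a : ℕ → ℝ), Monotone a ∧ a 0 = 0 ∧ a n = l ∧ (∀ i, a i ≤ l) ∧
      (∀ v, ∀ i < n, a i < g v → a (i + 1) ≤ g v) ∧
      ∀ (μ : ∀ i, RandPart w G {v ∈ A | g v ≤ a i} L)
        (ν : ∀ i, RandPart w G (A \ {v ∈ A | g v ≤ a i}) L),
      ∃ κ : RandPart w G A L, ∀ (z : V) (B : Set V) (γ K θ φ : ℝ) (f : ℕ → ℝ),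
        IsStar w G z B γ → 0 ≤ γ → B ⊆ A → 0 ≤ K → 0 ≤ θ →
        (∀ u ∈ B, ∀ v ∈ B, ∀ a, WalkIn w G B u v a → g u ≤ K * a + g v) →
        (∀ i < n, B ⊆ {v ∈ A | g v ≤ a i} → θ ≤ (μ i).prob z B) →
        (∀ i < n, B ⊆ A \ {v ∈ A | g v ≤ a i} →
          θ * (Real.exp (-(K * (2 * γ))) - (1 - Real.exp (-(K * (2 * γ)))) * ε * f i) ≤
            (ν i).prob z B) →
        (∀ s ∈ B, (∀ u ∈ B, g s ≤ g u) → g z ≤ g s + K * γ → ∀ j ≤ n, a j = g s →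
          ∑ i ∈ range j, gap a i * f i + (1 - Real.exp (-l)) ≤ (1 - Real.exp (-l)) * φ) →
        (∀ s ∈ B, (∀ u ∈ B, g s ≤ g u) → l < g s →
          ∑ i ∈ range n, gap a i * f i ≤ (1 - Real.exp (-l)) * φ) →
        θ * (Real.exp (-(K * (2 * γ))) - (1 - Real.exp (-(K * (2 * γ)))) * ε * φ) ≤
          κ.prob z B := by
  classical
  obtain ⟨n, a, ha, h0, hn, hal, hval⟩ := exists_breakpoints (Set.toFinite (Set.range g)).toFinset
    (fun x hx => by
      obtain ⟨v, rfl⟩ : x ∈ Set.range g := by simpa using hx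
      exact hg0 v) hl.le
  have hval' : ∀ v, g v ≤ l → ∃ j ≤ n, a j = g v := fun v hv => hval _ (by simp) hv
  refine ⟨n, a, ha, h0, hn, hal, fun v i hi hiv => ?_, fun μ ν => ?_⟩
  · rcases le_or_gt (g v) l with h | h
    · obtain ⟨j, -, hj⟩ := hval' v h
      rw [← hj] at hiv ⊢
      exact ha (ha.reflect_lt hiv)
    · exact (hal _).trans h.le
  have hZ : 0 < 1 - Real.exp (-l) := by simpa using hl
  obtain ⟨κ, hκ⟩ := RandPart.exists_combine (n := n) (p := gap a) (gap_nonneg ha) hZ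
    (by rw [sum_gap, h0, hn, neg_zero, Real.exp_zero]) (fun i => Set.sep_subset A _) μ ν
  refine ⟨κ, fun z B γ K θ φ f hB hγ hBA hK hθ hg hμ hν h1 h2 => ?_⟩
  obtain ⟨s, hs, t, ht, hsm, htm, hst, hz⟩ := hB.exists_extrema hK hg
  have key := le_sum_gap_mul (n := n) (D := K * (2 * γ)) (sm := g s) (sp := g t) (θ := θ) (φ := φ)
    (f := f) (x := fun i => if z ∈ {v ∈ A | g v ≤ a i} then (μ i).prob z B else (ν i).prob z B)
    ha h0 hn hε hθ hε0
    (by positivity) (hsm t ht) hst (hval' s) (hval' t) ?_ ?_ ?_ (fun j hj => h1 s hs hsm hz j hj)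
    (h2 s hs hsm)
  · refine le_of_mul_le_mul_left (key.trans (le_of_eq ?_)) hZ
    rw [← hκ]
    exact sum_congr rfl fun i _ => by congr
  · intro i hi his
    have : B ⊆ A \ {v ∈ A | g v ≤ a i} := fun u hu =>
      ⟨hBA hu, fun h => absurd h.2 (not_le.2 (his.trans_le (hsm u hu)))⟩
    simp only [(this hB.1).2, if_false]
    exact hν i hi this
  · intro i hi hti
    have : B ⊆ {v ∈ A | g v ≤ a i} := fun u hu => ⟨hBA hu, (htm u hu).trans hti⟩
    simp only [this hB.1, if_true]
    exact hμ i hi this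
  · intro i _
    split_ifs
    exacts [RandPart.prob_nonneg _ _ _, RandPart.prob_nonneg _ _ _]

open Classical in
/-- Random partition of `S` into clusters around the centres `N`, where every vertex of `S` is
within `ρ` of some centre; the padding degrades with the number of centres nearby. -/
theorem exists_randPart_of_cover [Finite V] (hw : ∀ e, 0 ≤ w e) (hl : 0 < l)
    (hε : ε * (1 - Real.exp (-l)) = Real.exp (-l)) (hε0 : 0 ≤ ε) (hM : ρ + l < M) (N : Finset V) :
    ∀ S : Set V, (∀ v ∈ S, ∃ x ∈ N, ∃ a ≤ ρ, WalkIn w G S v x a) →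
      ∃ μ : RandPart w G S (2 * (ρ + l)), ∀ (z : V) (B : Set V) (γ : ℝ),
        IsStar w G z B γ → 0 ≤ γ → γ ≤ 1 → B ⊆ S →
        Real.exp (-(2 * (2 * γ))) - (1 - Real.exp (-(2 * (2 * γ)))) * ε *
          ((N.filter fun x => ∃ a ≤ ρ + l + 1, WalkIn w G S z x a).card : ℝ) ≤ μ.prob z B := by
  induction N using Finset.strongInductionOn with
  | _ N ih =>
  intro S hcov
  rcases N.eq_empty_or_nonempty with rfl | ⟨x, hxN⟩
  · have hS : ∀ v, v ∉ S := fun v hv => by simpa using hcov v hv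
    refine ⟨.single fun u hu => absurd hu (hS u), fun z B γ hB _ _ hBS => absurd (hBS hB.1) (hS z)⟩
  set Dx : V → ℝ := distTo w G M S {x} with hDx
  set D' : V → ℝ := distTo w G M S (N.erase x : Finset V) with hD'
  set g : V → ℝ := fun v => max 0 (Dx v - D' v) with hg
  obtain ⟨n, a, ha, h0, hn, hal, -, hκ⟩ := exists_threshold (w := w) (G := G)
    (L := 2 * (ρ + l)) hl hε hε0 S (g := g) (fun v => le_max_left _ _)
  have ha0 : ∀ i, 0 ≤ a i := fun i => h0 ▸ ha (Nat.zero_le i)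
  have hga : ∀ v i, g v ≤ a i ↔ Dx v ≤ D' v + a i := by
    intro v i
    simp only [hg, max_le_iff, ha0 i, true_and]
    constructor <;> intro h <;> linarith
  have hcov' : ∀ v ∈ S, Dx v ≤ ρ ∨ D' v ≤ ρ := by
    intro v hv
    obtain ⟨y, hy, b, hb, h⟩ := hcov v hv
    by_cases hyx : y = x
    · subst hyx
      exact .inl ((distTo_le hw (Set.mem_singleton _) h).trans hb)
    · exact .inr ((distTo_le hw (by simp [hy, hyx]) h).trans hb)
  have hDx_le : ∀ v ∈ S, g v ≤ l → Dx v ≤ ρ + l := by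
    intro v hv hgl
    have : Dx v - D' v ≤ l := (le_max_right _ _).trans hgl
    rcases hcov' v hv with h | h <;> linarith
  have hcl : ∀ i, ∀ v ∈ {v ∈ S | g v ≤ a i}, WalkIn w G {v ∈ S | g v ≤ a i} v x (Dx v) := by
    rintro i v ⟨hv, hgv⟩
    have h1 := hDx_le v hv (hgv.trans (hal i))
    have hatt : WalkIn w G S v x (Dx v) := by
      rcases distTo_eq_cap_or (G := G) (M := M) (C := S) (T := {x}) (v := v) hw with h | ⟨y, hy, h⟩
      · rw [← hDx] at h; linarith
      · rwa [Set.mem_singleton_iff.1 hy] at h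
    refine hatt.restrict_geodesic hw (T := {x}) rfl rfl hgv fun y z hy hz hadj h hgy => ?_
    have h2 := distTo_le_add (M := M) (T := (N.erase x : Finset V)) hw
      (WalkIn.single (w := w) hy hz hadj)
    rw [hga] at hgy ⊢
    rw [← hDx] at h
    rw [← hD'] at h2
    linarith
  have hdiam : ∀ i, ∀ u ∈ {v ∈ S | g v ≤ a i}, ∀ v ∈ {v ∈ S | g v ≤ a i},
      ∃ b ≤ 2 * (ρ + l), WalkIn w G {v ∈ S | g v ≤ a i} u v b := fun i u hu v hv =>
    ⟨_, by linarith [hDx_le u hu.1 (hu.2.trans (hal i)), hDx_le v hv.1 (hv.2.trans (hal i))],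
      (hcl i u hu).trans (hcl i v hv).symm⟩
  let N' : ℕ → Finset V := fun i => (N.erase x).filter fun y => y ∉ {v ∈ S | g v ≤ a i}
  have hN' : ∀ i, N' i ⊂ N := fun i =>
    (Finset.filter_subset _ _).trans_ssubset (Finset.erase_ssubset hxN)
  have hrest : ∀ i, ∀ v ∈ S \ {v ∈ S | g v ≤ a i}, ∃ y ∈ N' i, ∃ b ≤ ρ,
      WalkIn w G (S \ {v ∈ S | g v ≤ a i}) v y b := by
    rintro i v ⟨hv, hgv⟩
    have hgv' : ¬ g v ≤ a i := fun h => hgv ⟨hv, h⟩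
    have h1 : D' v ≤ ρ := by
      rw [hga] at hgv'
      rcases hcov' v hv with h | h <;> linarith [ha0 i]
    obtain ⟨y, hy, hatt⟩ : ∃ y ∈ ((N.erase x : Finset V) : Set V), WalkIn w G S v y (D' v) := by
      rcases distTo_eq_cap_or (G := G) (M := M) (C := S) (T := (N.erase x : Finset V)) (v := v) hw
        with h | h
      · rw [← hD'] at h; linarith
      · exact h
    have h2 := hatt.restrict_geodesic hw (P := fun u => ¬ g u ≤ a i) hy rfl hgv'
      fun y z hy hz hadj h hgy => by
        have h2 := distTo_le_add (M := M) (T := {x}) hw (WalkIn.single (w := w) hy hz hadj)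
        rw [hga] at hgy ⊢
        rw [← hD'] at h
        rw [← hDx] at h2
        linarith
    have h3 : {u | u ∈ S ∧ ¬ g u ≤ a i} = S \ {v ∈ S | g v ≤ a i} := by
      ext u; simp +contextual
    rw [h3] at h2
    exact ⟨y, Finset.mem_filter.2 ⟨hy, h2.right_mem.2⟩, _, h1, h2⟩
  choose ν hν using fun i => ih (N' i) (hN' i) _ (hrest i)
  obtain ⟨κ, hκ⟩ := hκ (fun i => .single (hdiam i)) ν
  refine ⟨κ, fun z B γ hB hγ hγ1 hBS => ?_⟩
  set Φ : Finset V := N.filter fun x => ∃ a ≤ ρ + l + 1, WalkIn w G S z x a with hΦ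
  let F : ℕ → Finset V := fun i => (N' i).filter fun x =>
    ∃ b ≤ ρ + l + 1, WalkIn w G (S \ {v ∈ S | g v ≤ a i}) z x b
  have hF : ∀ i, F i ⊆ Φ := by
    intro i y hy
    obtain ⟨hy, b, hb, h⟩ := Finset.mem_filter.1 hy
    exact Finset.mem_filter.2 ⟨(hN' i).1 hy, b, hb, h.mono Set.sdiff_subset⟩
  have hZ : 0 ≤ 1 - Real.exp (-l) := sub_nonneg.2 (Real.exp_le_one_iff.2 (by linarith))
  have := hκ z B γ 2 1 Φ.card (fun i => (F i).card) hB hγ hBS zero_le_two zero_le_one ?_ ?_ ?_ ?_ ?_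
  · simpa using this
  · intro u hu v hv b hb
    have hb' := hb.mono hBS
    have h1 : Dx u ≤ b + Dx v := distTo_le_add hw hb'
    have h2 : D' v ≤ b + D' u := distTo_le_add hw hb'.symm
    have h3 := hb.nonneg hw
    refine max_le ?_ ?_
    · linarith [le_max_left 0 (Dx v - D' v)]
    · linarith [le_max_right 0 (Dx v - D' v)]
  · intro i _ hBi
    rw [RandPart.prob_single _ _ hBi]
  · intro i _ hBi
    rw [one_mul]
    exact hν i z B γ hB hγ hγ1 hBi
  · intro s hs _ _ j hj hjs
    have hx : x ∈ Φ := by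
      obtain ⟨b, hb, h⟩ := hB.2 s hs
      have h1 := hcl j s ⟨hBS hs, hjs.ge⟩
      have h2 := hDx_le s (hBS hs) (hjs ▸ hal j)
      exact Finset.mem_filter.2 ⟨hxN, _, by linarith,
        (h.mono hBS).symm.trans (h1.mono (Set.sep_subset S _))⟩
    have hcard : ∀ i, ((F i).card : ℝ) ≤ Φ.card - 1 := by
      intro i
      have hxF : x ∉ F i := fun h => by simp [F, N'] at h
      have := Finset.card_le_card (Finset.insert_subset hx (hF i))
      rw [Finset.card_insert_of_notMem hxF] at this
      have : ((F i).card : ℝ) + 1 ≤ Φ.card := by exact_mod_cast this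
      linarith
    have h1 : ∑ i ∈ Finset.range j, gap a i * ((F i).card : ℝ) ≤
        ∑ i ∈ Finset.range j, gap a i * ((Φ.card : ℝ) - 1) :=
      Finset.sum_le_sum fun i _ => mul_le_mul_of_nonneg_left (hcard i) (gap_nonneg ha i)
    rw [← Finset.sum_mul, sum_gap, h0, neg_zero, Real.exp_zero] at h1
    have h2 : (0 : ℝ) ≤ Φ.card - 1 := (Nat.cast_nonneg _).trans (hcard 0)
    have h3 : 1 - Real.exp (-a j) ≤ 1 - Real.exp (-l) := by
      have := Real.exp_le_exp.2 (neg_le_neg (hal j))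
      linarith
    have := mul_le_mul_of_nonneg_right h3 h2
    linarith
  · intro s _ _ _
    have h1 : ∑ i ∈ Finset.range n, gap a i * ((F i).card : ℝ) ≤
        ∑ i ∈ Finset.range n, gap a i * (Φ.card : ℝ) :=
      Finset.sum_le_sum fun i _ => mul_le_mul_of_nonneg_left
        (by exact_mod_cast Finset.card_le_card (hF i)) (gap_nonneg ha i)
    rwa [← Finset.sum_mul, sum_gap, h0, hn, neg_zero, Real.exp_zero] at h1

end Threshold

section Net

variable {V : Type*} {w : Sym2 V → ℝ} {G : SimpleGraph V} {S T : Set V} {l M ε : ℝ}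

open Classical in
/-- A separated set on few geodesics towards a common root meets every ball in few points. -/
theorem card_net_le (hl : 0 < l) {h : V → ℝ}
    (hLip : ∀ u v a, WalkIn w G S u v a → h u ≤ a + h v) {ι : Type*} (s : Finset ι) (P : ι → Set V)
    (hPS : ∀ i ∈ s, P i ⊆ S)
    (hP : ∀ i ∈ s, ∀ u ∈ P i, ∀ u' ∈ P i, WalkIn w G (P i) u u' |h u - h u'|) (N : Finset V)
    (hN : ∀ x ∈ N, ∃ i ∈ s, x ∈ P i)
    (hsep : ∀ x ∈ N, ∀ y ∈ N, x ≠ y → ∀ a ≤ l, ¬ WalkIn w G S x y a) (z : V) :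
    (N.filter fun x => ∃ a ≤ 4 * l, WalkIn w G S z x a).card ≤ s.card * 9 := by
  set Φ := N.filter fun x => ∃ a ≤ 4 * l, WalkIn w G S z x a
  have hsub : Φ ⊆ s.biUnion fun i => Φ.filter (· ∈ P i) := by
    intro x hx
    obtain ⟨i, hi, hxi⟩ := hN x (Finset.mem_filter.1 hx).1
    exact Finset.mem_biUnion.2 ⟨i, hi, Finset.mem_filter.2 ⟨hx, hxi⟩⟩
  refine (Finset.card_le_card hsub).trans (Finset.card_biUnion_le_card_mul _ _ _ fun i hi => ?_)
  have hcard : (Finset.Icc (⌊h z / l⌋ - 4) (⌊h z / l⌋ + 4)).card = 9 := by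
    rw [Int.card_Icc]; omega
  rw [← hcard]
  refine Finset.card_le_card_of_injOn (fun x => ⌊h x / l⌋) ?_ ?_
  · intro x hx
    obtain ⟨hx, -⟩ := Finset.mem_filter.1 hx
    obtain ⟨-, a, ha, hzx⟩ := Finset.mem_filter.1 hx
    have h1 := hLip _ _ _ hzx
    have h2 := hLip _ _ _ hzx.symm
    have h3 : h z / l - (4 : ℤ) ≤ h x / l := by
      rw [div_sub' hl.ne', div_le_div_iff_of_pos_right hl]; push_cast; linarith
    have h4 : h x / l ≤ h z / l + (4 : ℤ) := by
      rw [div_add' _ _ _ hl.ne', div_le_div_iff_of_pos_right hl]; push_cast; linarith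
    have h5 := Int.floor_mono h3
    have h6 := Int.floor_mono h4
    rw [Int.floor_sub_intCast] at h5
    rw [Int.floor_add_intCast] at h6
    exact Finset.mem_coe.2 (Finset.mem_Icc.2 ⟨h5, h6⟩)
  · intro x hx y hy hxy
    by_contra hne
    obtain ⟨hx, hxi⟩ := Finset.mem_filter.1 hx
    obtain ⟨hy, hyi⟩ := Finset.mem_filter.1 hy
    have h1 := Int.abs_sub_lt_one_of_floor_eq_floor hxy
    rw [← sub_div, abs_div, abs_of_pos hl, div_lt_one hl] at h1
    exact hsep x (Finset.mem_filter.1 hx).1 y (Finset.mem_filter.1 hy).1 hne _ h1.le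
      ((hP i hi x hxi y hyi).mono (hPS i hi))

/-- A maximal `l`-separated subset of `T` in `G[S]` is an `l`-net. -/
theorem exists_net [Finite V] (hl : 0 ≤ l) (hT : T ⊆ S) :
    ∃ N : Finset V, (∀ x ∈ N, x ∈ T) ∧
      (∀ x ∈ N, ∀ y ∈ N, x ≠ y → ∀ a ≤ l, ¬ WalkIn w G S x y a) ∧
      ∀ v ∈ T, ∃ x ∈ N, ∃ a ≤ l, WalkIn w G S v x a := by
  classical
  obtain ⟨N, ⟨hNT, hsep⟩, hmax⟩ := Set.exists_max_image
    {N : Finset V | (∀ x ∈ N, x ∈ T) ∧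
      (∀ x ∈ N, ∀ y ∈ N, x ≠ y → ∀ a ≤ l, ¬ WalkIn w G S x y a)} Finset.card (Set.toFinite _)
    ⟨∅, by simp, by simp⟩
  refine ⟨N, hNT, hsep, fun v hv => ?_⟩
  by_contra! hcon
  have hvN : v ∉ N := fun h => hcon v h 0 hl (.nil (hT hv))
  have := hmax (insert v N) ⟨?_, ?_⟩
  · rw [Finset.card_insert_of_notMem hvN] at this
    omega
  · intro x hx
    rcases Finset.mem_insert.1 hx with rfl | hx
    exacts [hv, hNT x hx]
  · intro x hx y hy hne a ha h
    rcases Finset.mem_insert.1 hx with rfl | hx' <;> rcases Finset.mem_insert.1 hy with rfl | hy'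
    · exact hne rfl
    · exact hcon y hy' a ha h
    · exact hcon x hx' a ha h.symm
    · exact hsep x hx' y hy' hne a ha h

/-- Random partition of the `l`-neighbourhood `S` of few geodesics towards a common root. -/
theorem exists_randPart_of_geodesics [Finite V] (hw : ∀ e, 0 ≤ w e) (hl : 1 ≤ l)
    (hε : ε * (1 - Real.exp (-l)) = Real.exp (-l)) (hε0 : 0 ≤ ε) (hM : 2 * l + l < M) {h : V → ℝ}
    (hLip : ∀ u v a, WalkIn w G S u v a → h u ≤ a + h v) {ι : Type*} (s : Finset ι) (P : ι → Set V)
    (hs : ε * (s.card * 9) ≤ 1) (hPS : ∀ i ∈ s, P i ⊆ S)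
    (hP : ∀ i ∈ s, ∀ u ∈ P i, ∀ u' ∈ P i, WalkIn w G (P i) u u' |h u - h u'|)
    (hS : ∀ v ∈ S, ∃ i ∈ s, ∃ x ∈ P i, ∃ a ≤ l, WalkIn w G S v x a) :
    ∃ μ : RandPart w G S (2 * (2 * l + l)), ∀ (z : V) (B : Set V) (γ : ℝ),
      IsStar w G z B γ → 0 ≤ γ → γ ≤ 1 → B ⊆ S → 1 - 8 * γ ≤ μ.prob z B := by
  classical
  obtain ⟨N, hNT, hsep, hnet⟩ := exists_net (w := w) (G := G) (l := l) (S := S)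
    (T := {x | ∃ i ∈ s, x ∈ P i}) (by linarith) (by rintro x ⟨i, hi, hx⟩; exact hPS i hi hx)
  obtain ⟨μ, hμ⟩ := exists_randPart_of_cover (w := w) (G := G) (M := M) (ρ := 2 * l) hw
    (by linarith) hε hε0 hM N S (fun v hv => by
      obtain ⟨i, hi, x, hx, a, ha, hvx⟩ := hS v hv
      obtain ⟨y, hy, b, hb, hxy⟩ := hnet x ⟨i, hi, hx⟩
      exact ⟨y, hy, _, by linarith, hvx.trans hxy⟩)
  refine ⟨μ, fun z B γ hB hγ hγ1 hBS => le_trans ?_ (hμ z B γ hB hγ hγ1 hBS)⟩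
  have hcard : ((N.filter fun x => ∃ a ≤ 2 * l + l + 1, WalkIn w G S z x a).card : ℝ) ≤
      s.card * 9 := by
    have h1 := card_net_le (by linarith : 0 < l) hLip s P hPS hP N hNT hsep z
    have h2 : (N.filter fun x => ∃ a ≤ 2 * l + l + 1, WalkIn w G S z x a) ⊆
        N.filter fun x => ∃ a ≤ 4 * l, WalkIn w G S z x a :=
      Finset.monotone_filter_right N (by
        rintro x - ⟨a, ha, h⟩
        exact ⟨a, by linarith, h⟩)
    exact_mod_cast (Finset.card_le_card h2).trans h1
  have h3 := (mul_le_mul_of_nonneg_left hcard hε0).trans hs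
  have hb : Real.exp (-(2 * (2 * γ))) ≤ 1 := Real.exp_le_one_iff.2 (by linarith)
  have h4 := mul_le_mul_of_nonneg_left h3 (sub_nonneg.2 hb)
  have h5 := Real.add_one_le_exp (-(2 * (2 * γ)))
  linarith

end Net

section State

variable {V : Type*} {w : Sym2 V → ℝ} {G : SimpleGraph V} {A S₀ : Set V} {𝒮 : Set (Set V)}
  {z : V}

/-- `x` has a neighbour in `S`. -/
def Touches (G : SimpleGraph V) (x : V) (S : Set V) : Prop :=
  ∃ s ∈ S, G.Adj x s

/-- Invariant of the decomposition: `A` is the part that is still to be partitioned, `𝒮` is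
the collection of supernodes that have been cut out, and two supernodes touched by the same
component of `A` are adjacent. -/
structure State (w : Sym2 V → ℝ) (G : SimpleGraph V) (A : Set V) (𝒮 : Set (Set V)) : Prop where
  nonempty : ∀ S ∈ 𝒮, S.Nonempty
  conn : ∀ S ∈ 𝒮, ∀ u ∈ S, ∀ v ∈ S, ∃ a, WalkIn w G S u v a
  disj : ∀ S ∈ 𝒮, ∀ S' ∈ 𝒮, S ≠ S' → Disjoint S S'
  disj_left : ∀ S ∈ 𝒮, Disjoint S A
  adj : ∀ S ∈ 𝒮, ∀ S' ∈ 𝒮, S ≠ S' → ∀ x x' a, WalkIn w G A x x' a → Touches G x S →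
    Touches G x' S' → ∃ s ∈ S, Touches G s S'

theorem State.insert (h : State w G A 𝒮) (hne : S₀.Nonempty) (hS₀ : S₀ ⊆ A)
    (hconn : ∀ u ∈ S₀, ∀ v ∈ S₀, ∃ a, WalkIn w G S₀ u v a)
    (hfull : ∀ S ∈ 𝒮, ∀ x ∈ S₀, ∀ y a, WalkIn w G A x y a → Touches G y S →
      ∃ s ∈ S₀, Touches G s S) :
    State w G (A \ S₀) (Insert.insert S₀ 𝒮) where
  nonempty := by rintro S (rfl | hS); exacts [hne, h.nonempty S hS]
  conn := by rintro S (rfl | hS); exacts [hconn, h.conn S hS]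
  disj := by
    have hd : ∀ S ∈ 𝒮, Disjoint S S₀ := fun S hS => (h.disj_left S hS).mono_right hS₀
    rintro S (rfl | hS) S' (rfl | hS') hne
    exacts [absurd rfl hne, (hd S' hS').symm, hd S hS, h.disj S hS S' hS' hne]
  disj_left := by
    rintro S (rfl | hS)
    exacts [Set.disjoint_sdiff_right, (h.disj_left S hS).mono_right Set.sdiff_subset]
  adj := by
    have key : ∀ S ∈ 𝒮, ∀ x x' a, WalkIn w G (A \ S₀) x x' a → Touches G x S₀ →
        Touches G x' S → ∃ s ∈ S₀, Touches G s S := by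
      rintro S hS x x' a hx ⟨s, hs, hxs⟩ hx'
      exact hfull S hS s hs x' _ (.cons (hS₀ hs) hxs.symm (hx.mono Set.sdiff_subset)) hx'
    rintro S (rfl | hS) S' (rfl | hS') hne x x' a hx h1 h2
    · exact absurd rfl hne
    · exact key S' hS' x x' a hx h1 h2
    · obtain ⟨s, hs, t, ht, hst⟩ := key S hS x' x a hx.symm h2 h1
      exact ⟨t, ht, s, hs, hst.symm⟩
    · exact h.adj S hS S' hS' hne x x' a (hx.mono Set.sdiff_subset) h1 h2

theorem connected_of_walkIn (hne : S₀.Nonempty)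
    (h : ∀ u ∈ S₀, ∀ v ∈ S₀, ∃ a, WalkIn w G S₀ u v a) : (G.induce S₀).Connected := by
  have : Nonempty S₀ := hne.to_subtype
  refine ⟨fun u v => ?_⟩
  obtain ⟨a, ha⟩ := h u u.2 v v.2
  exact ⟨ha.exists_induce_walk.choose⟩

/-- Together with a component of `A`, the supernodes it touches form a clique minor. -/
theorem State.length_lt (h : State w G A 𝒮) {r : ℕ} (hr : ¬ HasCliqueMinor G r) (hz : z ∈ A)
    {l : List (Set V)} (hl : l.Nodup)
    (hl' : ∀ S ∈ l, S ∈ 𝒮 ∧ ∃ y a, WalkIn w G A z y a ∧ Touches G y S) : l.length + 1 < r := by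
  by_contra! hlen
  apply hr
  set C : Set V := {v | ∃ a, WalkIn w G A z v a} with hC
  have hzC : z ∈ C := ⟨0, .nil hz⟩
  have hCA : C ⊆ A := by rintro v ⟨a, ha⟩; exact ha.right_mem
  have hCz : ∀ v ∈ C, ∃ a, WalkIn w G C z v a := by
    rintro v ⟨a, ha⟩
    have := ha.restrict (P := (· ∈ C)) hzC fun x y hx hy hxy ⟨b, hb⟩ =>
      ⟨_, hb.trans (.single hx hy hxy)⟩
    exact ⟨a, this.mono fun x hx => hx.2⟩
  have hadj : ∀ S ∈ l, ∀ S' ∈ l, S ≠ S' → ∃ s ∈ S, Touches G s S' := by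
    intro S hS S' hS' hne
    obtain ⟨hS, y, a, hy, hyS⟩ := hl' S hS
    obtain ⟨hS', y', a', hy', hyS'⟩ := hl' S' hS'
    exact h.adj S hS S' hS' hne y y' _ (hy.symm.trans hy') hyS hyS'
  have hCS : ∀ S ∈ l, ∃ s ∈ C, Touches G s S := by
    intro S hS
    obtain ⟨hS, y, a, hy, hyS⟩ := hl' S hS
    exact ⟨y, ⟨a, hy⟩, hyS⟩
  have hCl : ∀ S ∈ l, Disjoint S C := fun S hS => (h.disj_left S (hl' S hS).1).mono_right hCA
  have hnd : (C :: l).Nodup := List.nodup_cons.2 ⟨fun hm => by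
    have := hCl C hm
    rw [disjoint_self] at this
    exact absurd hzC (by rw [this]; exact Set.notMem_empty z), hl⟩
  have hlen' : r ≤ (C :: l).length := by simpa using hlen
  refine ⟨fun i => (C :: l)[i.1], fun i => ?_, fun i j hij => ?_, fun i j hij => ?_⟩
  · change (G.induce (C :: l)[i.1]).Connected
    rcases List.mem_cons.1 (List.getElem_mem (i.2.trans_le hlen')) with hi | hi
    · rw [hi]
      exact connected_of_walkIn (w := w) ⟨z, hzC⟩ fun u hu v hv =>
        ⟨_, (hCz u hu).choose_spec.symm.trans (hCz v hv).choose_spec⟩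
    · exact connected_of_walkIn (h.nonempty _ (hl' _ hi).1) (h.conn _ (hl' _ hi).1)
  · have hne : (C :: l)[i.1] ≠ (C :: l)[j.1] := fun he =>
      hij (Fin.ext ((hnd.getElem_inj_iff).1 he))
    change Disjoint (C :: l)[i.1] (C :: l)[j.1]
    rcases List.mem_cons.1 (List.getElem_mem (i.2.trans_le hlen')) with hi | hi <;>
    rcases List.mem_cons.1 (List.getElem_mem (j.2.trans_le hlen')) with hj | hj
    · exact absurd (hi.trans hj.symm) hne
    · rw [hi]; exact (hCl _ hj).symm
    · rw [hj]; exact hCl _ hi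
    · exact h.disj _ (hl' _ hi).1 _ (hl' _ hj).1 hne
  · have hne : (C :: l)[i.1] ≠ (C :: l)[j.1] := fun he =>
      hij (Fin.ext ((hnd.getElem_inj_iff).1 he))
    change ∃ s ∈ (C :: l)[i.1], Touches G s (C :: l)[j.1]
    rcases List.mem_cons.1 (List.getElem_mem (i.2.trans_le hlen')) with hi | hi <;>
    rcases List.mem_cons.1 (List.getElem_mem (j.2.trans_le hlen')) with hj | hj
    · exact absurd (hi.trans hj.symm) hne
    · rw [hi]; exact hCS _ hj
    · rw [hj]
      obtain ⟨s, hs, t, ht, hst⟩ := hCS _ hi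
      exact ⟨t, ht, s, hs, hst.symm⟩
    · exact hadj _ hi _ hj hne

end State

section Skeleton

variable {V : Type*} {w : Sym2 V → ℝ} {G : SimpleGraph V} {A C T : Set V} {𝒮 : Set (Set V)}
  {v x z₀ : V} {a b l M ε : ℝ} {r : ℕ}

/-- The part of a geodesic before it enters a sublevel set of the distance. -/
theorem WalkIn.exists_exit [Finite V] (hw : ∀ e, 0 ≤ w e) (hb : 0 ≤ b) (hx : x ∈ T)
    (h : WalkIn w G C v x a) (ha : a = distTo w G M C T v) (hv : b < distTo w G M C T v) :
    ∃ y u c, WalkIn w G {u | u ∈ C ∧ b < distTo w G M C T u} v y c ∧ G.Adj y u ∧ u ∈ C ∧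
      distTo w G M C T u ≤ b ∧ c ≤ distTo w G M C T v - distTo w G M C T y := by
  induction h with
  | nil h => linarith
  | @cons y z x c hy hadj hp ih =>
    have h1 : distTo w G M C T z ≤ c := distTo_le hw hx hp
    have h2 := distTo_le_add (M := M) (T := T) hw (WalkIn.single (w := w) hy hp.left_mem hadj)
    have h3 : c = distTo w G M C T z := by linarith
    rcases le_or_gt (distTo w G M C T z) b with hz | hz
    · exact ⟨y, z, 0, .nil ⟨hy, hv⟩, hadj, hp.left_mem, hz, by linarith⟩
    · obtain ⟨y', u, c', h4, h5, h6, h7, h8⟩ := ih hx h3 hz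
      exact ⟨y', u, _, .cons ⟨hy, hv⟩ hadj h4, h5, h6, h7, by linarith⟩

/-- A component `C` of `A` contains a tree of geodesics touching all supernodes that `C` touches;
`g` is the distance to this tree in `G[C]`. Its small sublevel sets can be cut out as new
supernodes, and they have good random partitions. -/
theorem State.exists_skeleton [Finite V] (hw : ∀ e, 0 ≤ w e)
    (hM : ∀ F : Finset (Sym2 V), ∑ e ∈ F, w e < M) (hl : 1 ≤ l)
    (hε : ε * (1 - Real.exp (-l)) = Real.exp (-l)) (hε0 : 0 ≤ ε) (hMl : 2 * l + l < M)
    (hr : ¬ HasCliqueMinor G r) (hεr : ε * (r * 9) ≤ 1) (h : State w G A 𝒮) (hz₀ : z₀ ∈ A) :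
    ∃ (C : Set V) (g : V → ℝ), z₀ ∈ C ∧ g z₀ = 0 ∧ (∀ v, 0 ≤ g v) ∧ (∀ v ∉ C, l < g v) ∧
      (∀ u ∈ C, ∀ v a, WalkIn w G A u v a → v ∈ C) ∧
      (∀ u v a, WalkIn w G A u v a → g u ≤ a + g v) ∧
      (∀ v ∈ C, ∀ b, 0 ≤ b → b < g v → ∃ y u c, WalkIn w G (A \ {v ∈ A | g v ≤ b}) v y c ∧
        G.Adj y u ∧ u ∈ {v ∈ A | g v ≤ b} ∧ c ≤ g v - g y) ∧
      ∀ b, 0 ≤ b → b ≤ l →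
        State w G (A \ {v ∈ A | g v ≤ b}) (Insert.insert {v ∈ A | g v ≤ b} 𝒮) ∧
        ∃ μ : RandPart w G {v ∈ A | g v ≤ b} (2 * (2 * l + l)), ∀ (z : V) (B : Set V) (γ : ℝ),
          IsStar w G z B γ → 0 ≤ γ → γ ≤ 1 → B ⊆ {v ∈ A | g v ≤ b} →
          1 - 8 * γ ≤ μ.prob z B := by
  classical
  have hM0 : 0 ≤ M := by linarith
  set C : Set V := {v | ∃ a, WalkIn w G A v z₀ a} with hC
  have hz₀C : z₀ ∈ C := ⟨0, .nil hz₀⟩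
  have hCA : C ⊆ A := by rintro v ⟨a, ha⟩; exact ha.left_mem
  have hcl : ∀ u ∈ C, ∀ v a, WalkIn w G A u v a → v ∈ C := fun u ⟨b, hb⟩ v a hv =>
    ⟨_, hv.symm.trans hb⟩
  have hclC : ∀ u ∈ C, ∀ v a, WalkIn w G A u v a → WalkIn w G C u v a := fun u hu v a hv =>
    (hv.restrict (P := (· ∈ C)) hu fun x y hx hy hxy hxC =>
      hcl x hxC y _ (.single hx hy hxy)).mono fun x hx => hx.2
  set h₀ : V → ℝ := distTo w G M C {z₀} with hh₀
  have hP : ∀ x, ∃ P : Set V, x ∈ C → P ⊆ C ∧ x ∈ P ∧ z₀ ∈ P ∧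
      ∀ u ∈ P, ∀ u' ∈ P, WalkIn w G P u u' |h₀ u - h₀ u'| := by
    intro x
    by_cases hx : x ∈ C
    · obtain ⟨a, ha⟩ := hx
      have hx : x ∈ C := ⟨a, ha⟩
      obtain ⟨y, hy, h1⟩ := exists_walkIn_distTo (T := {z₀}) hw hM rfl (hclC x hx _ _ ha)
      obtain ⟨P, h2, h3, h4, -, h5⟩ := h1.exists_segment hw hy rfl
      rw [Set.mem_singleton_iff.1 hy] at h4
      exact ⟨P, fun _ => ⟨h2, h3, h4, h5⟩⟩
    · exact ⟨∅, fun h => absurd h hx⟩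
  choose P hP using hP
  set K : Finset (Set V) := (Set.toFinite {S | S ∈ 𝒮 ∧ ∃ y ∈ C, Touches G y S}).toFinset with hK
  have hKmem : ∀ S, S ∈ K ↔ S ∈ 𝒮 ∧ ∃ y ∈ C, Touches G y S := by simp [hK]
  have hend : ∀ S, ∃ y, S ∈ K → y ∈ C ∧ Touches G y S := by
    intro S
    by_cases hS : S ∈ K
    · obtain ⟨-, y, hy⟩ := (hKmem S).1 hS
      exact ⟨y, fun _ => hy⟩
    · exact ⟨z₀, fun h => absurd h hS⟩
  choose q hq using hend
  set X : Finset V := Insert.insert z₀ (K.image q) with hX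
  have hXC : ∀ x ∈ X, x ∈ C := by
    intro x hx
    rcases Finset.mem_insert.1 hx with rfl | hx
    · exact hz₀C
    · obtain ⟨S, hS, rfl⟩ := Finset.mem_image.1 hx
      exact (hq S hS).1
  have hXcard : X.card ≤ r := by
    have h1 := h.length_lt hr hz₀ (l := K.toList) K.nodup_toList fun S hS => by
      obtain ⟨h1, y, ⟨a, ha⟩, hy⟩ := (hKmem S).1 (Finset.mem_toList.1 hS)
      exact ⟨h1, y, a, ha.symm, hy⟩
    rw [Finset.length_toList] at h1
    have h2 := Finset.card_insert_le z₀ (K.image q)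
    have h3 := Finset.card_image_le (s := K) (f := q)
    rw [hX]
    omega
  set T : Set V := {t | ∃ x ∈ X, t ∈ P x} with hT
  have hTC : T ⊆ C := by rintro t ⟨x, hx, ht⟩; exact (hP x (hXC x hx)).1 ht
  have hXT : ∀ x ∈ X, x ∈ T := fun x hx => ⟨x, hx, (hP x (hXC x hx)).2.1⟩
  have hz₀T : z₀ ∈ T := hXT z₀ (Finset.mem_insert_self _ _)
  set D : V → ℝ := distTo w G M C T with hD
  set g : V → ℝ := fun v => if v ∈ C then D v else l + 1 with hg
  have hgC : ∀ v ∈ C, g v = D v := fun v hv => if_pos hv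
  have hgC' : ∀ v ∉ C, g v = l + 1 := fun v hv => if_neg hv
  have hg0 : ∀ v, 0 ≤ g v := by
    intro v
    by_cases hv : v ∈ C
    · rw [hgC v hv]; exact distTo_nonneg hw hM0
    · rw [hgC' v hv]; linarith
  have hgT : ∀ t ∈ T, g t = 0 := fun t ht => by
    rw [hgC t (hTC ht)]; exact distTo_eq_zero hw hM0 (hTC ht) ht
  have hatt : ∀ v ∈ C, ∃ t ∈ T, WalkIn w G C v t (D v) := fun v hv =>
    exists_walkIn_distTo hw hM hz₀T (hclC v hv _ _ hv.choose_spec)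
  refine ⟨C, g, hz₀C, hgT z₀ hz₀T, hg0, fun v hv => by rw [hgC' v hv]; linarith, hcl, ?_, ?_, ?_⟩
  · intro u v a huv
    by_cases hu : u ∈ C
    · rw [hgC u hu, hgC v (hcl u hu v a huv)]
      exact distTo_le_add hw (hclC u hu v a huv)
    · have hv : v ∉ C := fun hv => hu (hcl v hv u a huv.symm)
      rw [hgC' u hu, hgC' v hv]
      linarith [huv.nonneg hw]
  · intro v hv b hb hbv
    obtain ⟨t, ht, hvt⟩ := hatt v hv
    rw [hgC v hv] at hbv ⊢
    obtain ⟨y, u, c, h1, h2, h3, h4, h5⟩ := hvt.exists_exit hw hb ht rfl hbv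
    refine ⟨y, u, c, h1.mono ?_, h2, ⟨hCA h3, by rwa [hgC u h3]⟩, ?_⟩
    · rintro x ⟨hxC, hx⟩
      exact ⟨hCA hxC, fun h => absurd h.2 (by rw [hgC x hxC]; exact not_le.2 hx)⟩
    · rwa [hgC y h1.right_mem.1]
  · intro b hb hbl
    have hSC : {v ∈ A | g v ≤ b} ⊆ C := by
      rintro v ⟨-, hv⟩
      by_contra hvC
      rw [hgC' v hvC] at hv
      linarith
    have hTS : T ⊆ {v ∈ A | g v ≤ b} := fun t ht => ⟨hCA (hTC ht), by rw [hgT t ht]; exact hb⟩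
    have hPS : ∀ x ∈ X, P x ⊆ {v ∈ A | g v ≤ b} := fun x hx t ht => hTS ⟨x, hx, ht⟩
    have hwalk : ∀ v ∈ {v ∈ A | g v ≤ b}, ∃ t ∈ T, WalkIn w G {v ∈ A | g v ≤ b} v t (D v) := by
      intro v hv
      obtain ⟨t, ht, hvt⟩ := hatt v (hSC hv)
      refine ⟨t, ht, (hvt.restrict_geodesic (P := fun u => D u ≤ b) hw ht rfl ?_ ?_).mono ?_⟩
      · rw [← hgC v (hSC hv)]; exact hv.2
      · intro y z hy hz hyz h1 h2
        rw [← hD] at h1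
        linarith [hw s(y, z)]
      · rintro u ⟨hu, hub⟩
        exact ⟨hCA hu, by rwa [hgC u hu]⟩
    have hroot : ∀ v ∈ {v ∈ A | g v ≤ b}, ∃ a, WalkIn w G {v ∈ A | g v ≤ b} v z₀ a := by
      intro v hv
      obtain ⟨t, ⟨x, hx, ht⟩, h1⟩ := hwalk v hv
      have h2 := hP x (hXC x hx)
      exact ⟨_, h1.trans ((h2.2.2.2 t ht z₀ h2.2.2.1).mono (hPS x hx))⟩
    refine ⟨h.insert ⟨z₀, hTS hz₀T⟩ (Set.sep_subset _ _) ?_ ?_, ?_⟩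
    · intro u hu v hv
      obtain ⟨a, ha⟩ := hroot u hu
      obtain ⟨a', ha'⟩ := hroot v hv
      exact ⟨_, ha.trans ha'.symm⟩
    · intro S hS x hx y a hxy hy
      have hSK : S ∈ K := (hKmem S).2 ⟨hS, y, hcl x (hSC hx) y a hxy, hy⟩
      exact ⟨q S, hTS (hXT _ (Finset.mem_insert_of_mem (Finset.mem_image_of_mem q hSK))),
        (hq S hSK).2⟩
    · refine exists_randPart_of_geodesics hw hl hε hε0 hMl (h := h₀)
        (fun u v a huv => distTo_le_add hw (huv.mono hSC)) X P ?_ hPS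
        (fun x hx => (hP x (hXC x hx)).2.2.2) ?_
      · refine le_trans (mul_le_mul_of_nonneg_left ?_ hε0) hεr
        have : (X.card : ℝ) ≤ r := by exact_mod_cast hXcard
        linarith
      · intro v hv
        obtain ⟨t, ⟨x, hx, ht⟩, h1⟩ := hwalk v hv
        refine ⟨x, hx, t, ht, _, ?_, h1⟩
        rw [← hgC v (hSC hv)]
        exact hv.2.trans hbl

end Skeleton

section Decomposition

variable {V : Type*} {w : Sym2 V → ℝ} {G : SimpleGraph V} {A : Set V} {𝒮 : Set (Set V)}
  {z : V} {l M ε η : ℝ} {r : ℕ}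

/-- A short walk from `z` avoids the small sublevel sets of a `1`-Lipschitz function. -/
theorem WalkIn.avoid (hw : ∀ e, 0 ≤ w e) {g : V → ℝ}
    (hg : ∀ u v a, WalkIn w G A u v a → g u ≤ a + g v) {z y : V} {a b : ℝ}
    (h : WalkIn w G A z y a) (hab : a < g z - b) :
    WalkIn w G (A \ {v ∈ A | g v ≤ b}) z y a := by
  induction h with
  | nil h => exact .nil ⟨h, fun h' => by linarith [h'.2]⟩
  | @cons u v _ _ hu h hp ih =>
    have h1 := hg _ _ _ (.single hu hp.left_mem h)
    have h2 := hp.nonneg hw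
    have h3 := hw s(u, v)
    exact .cons ⟨hu, fun h' => by linarith [h'.2]⟩ h (ih (by linarith))

/-- `L` lists supernodes touched by the component of `z`, with upper bounds on the distance from
`z` to a vertex touching them. -/
def IsRecord (w : Sym2 V → ℝ) (G : SimpleGraph V) (A : Set V) (𝒮 : Set (Set V)) (z : V)
    (L : List (Set V × ℝ)) : Prop :=
  (L.map Prod.fst).Nodup ∧
    ∀ p ∈ L, p.1 ∈ 𝒮 ∧ ∃ y a, a ≤ p.2 ∧ WalkIn w G A z y a ∧ Touches G y p.1

theorem IsRecord.perm {L L' : List (Set V × ℝ)} (h : IsRecord w G A 𝒮 z L) (hL : L'.Perm L) :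
    IsRecord w G A 𝒮 z L' :=
  ⟨(hL.map _).nodup_iff.2 h.1, fun p hp => h.2 p (hL.mem_iff.1 hp)⟩

theorem IsRecord.length_lt {L : List (Set V × ℝ)} (h : IsRecord w G A 𝒮 z L)
    (hA : State w G A 𝒮) (hr : ¬ HasCliqueMinor G r) (hz : z ∈ A) : L.length < r := by
  have := hA.length_lt hr hz h.1 fun S hS => by
    obtain ⟨p, hp, rfl⟩ := List.mem_map.1 hS
    obtain ⟨h1, y, a, -, h2⟩ := h.2 p hp
    exact ⟨h1, y, a, h2⟩
  rw [List.length_map] at this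
  omega

/-- The closeness of a recorded supernode. -/
noncomputable def closeness (p : Set V × ℝ) : ℝ :=
  Real.exp (-p.2 / 2)

theorem IsRecord.closeness_le_one (hw : ∀ e, 0 ≤ w e) {L : List (Set V × ℝ)}
    (h : IsRecord w G A 𝒮 z L) : ∀ y ∈ L.map closeness, y ≤ 1 := by
  intro y hy
  obtain ⟨p, hp, rfl⟩ := List.mem_map.1 hy
  obtain ⟨-, y, a, h1, h2, -⟩ := h.2 p hp
  have := h2.nonneg hw
  exact Real.exp_le_one_iff.2 (by linarith)

theorem closeness_nonneg (L : List (Set V × ℝ)) : ∀ y ∈ L.map closeness, 0 ≤ y := by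
  intro y hy
  obtain ⟨p, -, rfl⟩ := List.mem_map.1 hy
  exact Real.exp_nonneg _

theorem discount_nonneg {l : List ℝ} (h : ∀ y ∈ l, 0 ≤ y) : 0 ≤ discount l := by
  induction l with
  | nil => simp [discount]
  | cons y l ih =>
    have := ih fun y hy => h y (by simp [hy])
    have := h y (by simp)
    simp only [discount]; linarith

/-- After cutting out a supernode `S`, keep the recorded supernodes that are closer than `S`,
and add `S`. -/
theorem IsRecord.cut (hw : ∀ e, 0 ≤ w e) {L : List (Set V × ℝ)} (h : IsRecord w G A 𝒮 z L)
    (hA : State w G A 𝒮) {g : V → ℝ} (hg : ∀ u v a, WalkIn w G A u v a → g u ≤ a + g v) {b b' : ℝ}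
    {y : V} {c : ℝ} (hy : WalkIn w G (A \ {v ∈ A | g v ≤ b}) z y c)
    (hyS : Touches G y {v ∈ A | g v ≤ b}) (hc : c ≤ g z - b') :
    IsRecord w G (A \ {v ∈ A | g v ≤ b}) (Insert.insert {v ∈ A | g v ≤ b} 𝒮) z
      (L.takeWhile (fun p => Real.exp (-(g z - b) / 2) < closeness p) ++
        [({v ∈ A | g v ≤ b}, g z - b')]) := by
  have hS : {v ∈ A | g v ≤ b} ∉ 𝒮 := fun h' => by
    obtain ⟨s, hs, -⟩ := hyS
    exact Set.disjoint_left.1 (hA.disj_left _ h') hs hs.1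
  have hsub := (List.takeWhile_sublist
    (fun p : Set V × ℝ => decide (Real.exp (-(g z - b) / 2) < closeness p)) (l := L))
  constructor
  · rw [List.map_append, List.nodup_append]
    refine ⟨h.1.sublist (hsub.map _), by simp, ?_⟩
    rintro S hS₁ S' hS' rfl
    obtain ⟨p, hp, rfl⟩ := List.mem_map.1 hS₁
    have : p.1 = {v ∈ A | g v ≤ b} := by simpa using hS'
    exact hS (this ▸ (h.2 p (hsub.subset hp)).1)
  · intro p hp
    rcases List.mem_append.1 hp with hp | hp
    · obtain ⟨h1, y, a, h2, h3, h4⟩ := h.2 p (hsub.subset hp)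
      have h5 := List.mem_takeWhile_imp hp
      simp only [closeness, decide_eq_true_eq, Real.exp_lt_exp] at h5
      exact ⟨Or.inr h1, y, a, h2, h3.avoid hw hg (by linarith), h4⟩
    · rw [List.mem_singleton] at hp
      subst hp
      exact ⟨Or.inl rfl, y, c, hc, hy, hyS⟩

open Finset in
/-- The remaining vertices have a random partition whose padding is controlled by the potential
`1 - discount` of any record. -/
theorem State.exists_randPart [Finite V] (hw : ∀ e, 0 ≤ w e)
    (hM : ∀ F : Finset (Sym2 V), ∑ e ∈ F, w e < M) (hl : 1 ≤ l)
    (hε : ε * (1 - Real.exp (-l)) = Real.exp (-l)) (hε0 : 0 ≤ ε) (hMl : 2 * l + l < M)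
    (hr : ¬ HasCliqueMinor G r) (hεr : ε * (r * 9) ≤ 1)
    (hlr : Real.exp (-l / 2) ≤ (1 / 2) ^ r)
    (hη : η = (1 / 2) ^ r * Real.exp (-(l + 1) / 2)) (hεη : 2 * ε ≤ η) (A : Set V) :
    ∀ 𝒮, State w G A 𝒮 → ∃ μ : RandPart w G A (2 * (2 * l + l)),
      ∀ (z : V) (B : Set V) (γ : ℝ) (L : List (Set V × ℝ)), IsStar w G z B γ → 0 ≤ γ →
        γ ≤ 1 / 8 → B ⊆ A → IsRecord w G A 𝒮 z L →
        (1 - 8 * γ) * (Real.exp (-(1 * (2 * γ))) - (1 - Real.exp (-(1 * (2 * γ)))) * ε *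
          (2 / η * (1 - discount (L.map closeness)))) ≤ μ.prob z B := by
  have hη0 : 0 < η := by rw [hη]; positivity
  induction A using WellFoundedLT.induction with
  | ind A IH =>
  intro 𝒮 hA
  rcases A.eq_empty_or_nonempty with rfl | ⟨z₀, hz₀⟩
  · exact ⟨.single fun u hu => hu.elim, fun z B γ L hB _ _ hBA => (hBA hB.1).elim⟩
  obtain ⟨C, g, hz₀C, hgz₀, hg0, hgC, hcl, hg, hexit, hS⟩ :=
    hA.exists_skeleton hw hM hl hε hε0 hMl hr hεr hz₀
  obtain ⟨n, a, ha, h0, hn, hal, hstep, hκ⟩ := exists_threshold (w := w) (G := G)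
    (L := 2 * (2 * l + l)) (zero_lt_one.trans_le hl) hε hε0 A hg0
  have ha0 : ∀ i, 0 ≤ a i := fun i => h0 ▸ ha (Nat.zero_le i)
  choose hst μ hμ using fun i => hS (a i) (ha0 i) (hal i)
  choose ν hν using fun i => IH (A \ {v ∈ A | g v ≤ a i})
    ⟨Set.sdiff_subset, fun h => (h hz₀).2 ⟨hz₀, hgz₀ ▸ ha0 i⟩⟩ _ (hst i)
  obtain ⟨κ, hκ⟩ := hκ μ ν
  refine ⟨κ, fun z B γ L₀ hB hγ hγ1 hBA hL₀ => ?_⟩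
  obtain ⟨L, hperm, hsort, hdisc⟩ := exists_perm_sorted closeness L₀
  have hL := hL₀.perm hperm
  have hθ : 0 ≤ 1 - 8 * γ := by linarith
  have hβ : 0 ≤ 1 - Real.exp (-(1 * (2 * γ))) := by
    rw [sub_nonneg, Real.exp_le_one_iff]; linarith
  have hzA : z ∈ A := hBA hB.1
  have hlen := hL.length_lt hA hr hzA
  have hpow : (1 / 2 : ℝ) ^ r ≤ (1 / 2) ^ L.length :=
    pow_le_pow_of_le_one (by norm_num) (by norm_num) hlen.le
  set φ : ℝ := 2 / η * (1 - discount (L.map closeness)) with hφ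
  have hφ_le : φ ≤ 2 / η := by
    have := discount_nonneg (closeness_nonneg L)
    exact mul_le_of_le_one_right (by positivity) (by linarith)
  have hlε : Real.exp (-l) ≤ ε := by nlinarith [mul_nonneg hε0 (Real.exp_nonneg (-l))]
  have hlφ : Real.exp (-l) * φ ≤ 1 := by
    refine (mul_le_mul_of_nonneg_left hφ_le (Real.exp_nonneg _)).trans ?_
    rw [mul_div_assoc', div_le_one hη0]
    linarith
  suffices key : ∃ f : ℕ → ℝ,
      (∀ i < n, B ⊆ A \ {v ∈ A | g v ≤ a i} →
        (1 - 8 * γ) * (Real.exp (-(1 * (2 * γ))) - (1 - Real.exp (-(1 * (2 * γ)))) * ε * f i) ≤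
            (ν i).prob z B) ∧
      (∀ s ∈ B, (∀ u ∈ B, g s ≤ g u) → g z ≤ g s + 1 * γ → ∀ j ≤ n, a j = g s →
          ∑ i ∈ range j, gap a i * f i + (1 - Real.exp (-l)) ≤ (1 - Real.exp (-l)) * φ) ∧
      ∑ i ∈ range n, gap a i * f i ≤ (1 - Real.exp (-l)) * φ by
    obtain ⟨f, hf, h1, h2⟩ := key
    refine le_trans ?_ (hκ z B γ 1 (1 - 8 * γ) φ f hB hγ hBA zero_le_one hθ
      (fun u _ v _ a h => by rw [one_mul]; exact hg u v a (h.mono hBA))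
      (fun i _ hBi => hμ i z B γ hB hγ (by linarith) hBi) hf h1 fun _ _ _ _ => h2)
    gcongr
    exact mul_le_mul_of_nonneg_left (by linarith) (by positivity)
  by_cases hzC : z ∈ C
  · refine ⟨fun i => 2 / η * (1 - discount ((L.map closeness).takeWhile
      (fun y => Real.exp (-(g z - a i) / 2) < y) ++ [Real.exp (-(g z - a (i + 1)) / 2)])),
      fun i hi hBi => ?_, fun s hs hsm hzs j hj hjs => ?_, ?_⟩
    · have hzi : a i < g z := not_le.1 fun h => (hBi hB.1).2 ⟨hzA, h⟩
      obtain ⟨y, u, c, h1, h2, h3, h4⟩ := hexit z hzC (a i) (ha0 i) hzi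
      have h5 : a i < g y := not_le.1 fun h => h1.right_mem.2 ⟨h1.right_mem.1, h⟩
      have h6 := hstep y i hi h5
      have := hν i z B γ _ hB hγ hγ1 hBi
        (hL.cut (b' := a (i + 1)) hw hA hg h1 ⟨u, h3, h2⟩ (by linarith))
      rw [List.map_append] at this
      beta_reduce
      rw [List.takeWhile_map]
      exact this
    · have h1 := sum_gap_mul_le_of_le ha h0 (g := g z) hsort (hL.closeness_le_one hw)
        (hjs.trans_le (hsm z hB.1))
      have h2 : η ≤ (1 / 2) ^ L.length * Real.exp (-g z / 2) := by
        rw [hη]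
        have := hal j
        gcongr
        linarith
      rw [List.length_map] at h1
      have h3 := mul_le_mul_of_nonneg_left (h1.trans (sub_le_sub_left h2 _))
        (show 0 ≤ 2 / η by positivity)
      rw [mul_sum, mul_sub, div_mul_cancel₀ _ hη0.ne', ← hφ] at h3
      have h4 : ∀ x y : ℝ, x * (2 / η * y) = 2 / η * (x * y) := fun x y => by ring
      simp only [h4]
      linarith [Real.exp_nonneg (-l)]
    · have h1 := sum_gap_mul_le ha h0 (g := g z) hsort (closeness_nonneg L) (n := n)
        (by rw [hn, List.length_map]; exact hlr.trans hpow)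
      rw [hn] at h1
      have h3 := mul_le_mul_of_nonneg_left h1 (show 0 ≤ 2 / η by positivity)
      rw [mul_sum] at h3
      have h4 : ∀ x y : ℝ, x * (2 / η * y) = 2 / η * (x * y) := fun x y => by ring
      simp only [h4]
      rw [hφ, h4]
      exact h3
  · refine ⟨fun _ => φ, fun i hi hBi => ?_, fun s hs _ _ j _ hjs => ?_, ?_⟩
    · refine hν i z B γ L hB hγ hγ1 hBi ⟨hL.1, fun p hp => ?_⟩
      obtain ⟨h1, y, c, h2, h3, h4⟩ := hL.2 p hp
      refine ⟨Or.inr h1, y, c, h2, (h3.restrict (P := (· ∉ C)) hzC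
        fun x y hx hy hxy hxC hyC => hxC (hcl y hyC x _ (.single hy hx hxy.symm))).mono ?_, h4⟩
      rintro x ⟨hx, hxC⟩
      exact ⟨hx, fun h => absurd (h.2.trans (hal i)) (not_le.2 (hgC x hxC))⟩
    · exfalso
      obtain ⟨c, -, hc⟩ := hB.2 s hs
      have hsC : s ∈ C := by
        by_contra h
        exact absurd (hal j) (not_le.2 (hjs ▸ hgC s h))
      exact hzC (hcl s hsC z c (hc.mono hBA))
    · rw [← sum_mul, sum_gap, h0, hn, neg_zero, Real.exp_zero]

end Decomposition

section Assembly

variable {V : Type*} {w : Sym2 V → ℝ} {G : SimpleGraph V} {A C : Set V} {u v z : V}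
  {a k L : ℝ} {r : ℕ}

theorem WalkIn.smul (k : ℝ) (h : WalkIn w G C u v a) :
    WalkIn (fun e => k * w e) G C u v (k * a) := by
  induction h with
  | nil h => simpa using WalkIn.nil h
  | cons hu h _ ih => rw [mul_add]; exact .cons hu h ih

theorem isStar_setOf_walkIn (hw : ∀ e, 0 ≤ w e) (hz : z ∈ A) {γ : ℝ} (hγ : 0 ≤ γ) :
    IsStar w G z {u | ∃ a ≤ γ, WalkIn w G A u z a} γ := by
  refine ⟨⟨0, hγ, .nil hz⟩, ?_⟩
  rintro u ⟨a, ha, hu⟩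
  refine ⟨a, ha, ?_⟩
  induction hu with
  | nil h => exact .nil ⟨0, hγ, .nil h⟩
  | @cons u v _ _ hu h hp ih =>
    have := hw s(u, v)
    exact .cons ⟨_, ha, .cons hu h hp⟩ h (ih hz (by linarith))

theorem exists_forall_sum_lt [Finite V] (hw : ∀ e, 0 ≤ w e) (a : ℝ) :
    ∃ M, a < M ∧ ∀ F : Finset (Sym2 V), ∑ e ∈ F, w e < M := by
  classical
  have := Fintype.ofFinite (Sym2 V)
  refine ⟨max a (∑ e, w e) + 1, (le_max_left _ _).trans_lt (lt_add_one _), fun F => ?_⟩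
  exact ((Finset.sum_le_univ_sum_of_nonneg hw).trans (le_max_right _ _)).trans_lt (lt_add_one _)

/-- In a finite connected graph the distance is attained by a walk. -/
theorem exists_walkIn_wdist [Finite V] (hG : G.Connected) (hw : ∀ e, 0 ≤ w e) (u v : V) :
    ∃ a ≤ wdist w G u v, WalkIn w G Set.univ u v a := by
  obtain ⟨M, -, hM⟩ := exists_forall_sum_lt hw 0
  have hwalk : ∀ p : G.Walk u v, WalkIn w G Set.univ u v (walkWeight w p) := fun p =>
    .of_walk p fun _ _ => trivial
  obtain ⟨p⟩ := hG.preconnected u v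
  obtain ⟨x, rfl, hx⟩ := exists_walkIn_distTo (T := {v}) hw hM rfl (hwalk p)
  refine ⟨_, le_csInf ⟨_, p, rfl⟩ ?_, hx⟩
  rintro _ ⟨q, rfl⟩
  exact distTo_le hw rfl (hwalk q)

theorem exp_neg_two_mul_le {x : ℝ} (h0 : 0 ≤ x) (h1 : x ≤ 1 / 2) : Real.exp (-(2 * x)) ≤ 1 - x := by
  rw [Real.exp_neg]
  have h2 := Real.add_one_le_exp (2 * x)
  refine inv_le_of_inv_le₀ (by linarith) (le_trans ?_ h2)
  rw [inv_le_iff_one_le_mul₀ (by linarith)]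
  nlinarith

/-- A `K_r`-minor-free graph has a random partition into clusters of diameter `O(r)` such that
stars of radius `γ` are padded with probability `exp (-O(γ))`. -/
theorem exists_randPart_univ [Finite V] (hw : ∀ e, 0 ≤ w e) (hr2 : 1 ≤ r)
    (hr : ¬ HasCliqueMinor G r) :
    ∃ μ : RandPart w G Set.univ (48 * r), ∀ (z : V) (B : Set V) (γ : ℝ), IsStar w G z B γ →
      0 ≤ γ → γ ≤ 1 / 16 → Real.exp (-(24 * γ)) ≤ μ.prob z B := by
  have hr1 : (1 : ℝ) ≤ r := by exact_mod_cast hr2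
  set l : ℝ := 8 * r with hl
  set t : ℝ := Real.exp (-r) with ht
  have ht0 : 0 < t := Real.exp_pos _
  have hhalf : Real.exp (-1) ≤ 1 / 2 := by
    rw [Real.exp_neg, one_div]
    have := Real.exp_one_gt_d9
    exact inv_anti₀ two_pos (by linarith)
  have ht2 : t ≤ 1 / 2 := (Real.exp_le_exp.2 (by linarith)).trans hhalf
  have htr : t * r ≤ 1 := by
    have h1 := Real.add_one_le_exp (r : ℝ)
    have h2 : t * Real.exp r = 1 := by rw [ht, ← Real.exp_add]; simp
    nlinarith
  have htl : Real.exp (-l) = t ^ 8 := by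
    rw [ht, ← Real.exp_nat_mul, hl]; congr 1; push_cast; ring
  have htp : t ≤ (1 / 2) ^ r := by
    have : t = Real.exp (-1) ^ r := by rw [← Real.exp_nat_mul, ht]; congr 1; ring
    rw [this]
    exact pow_le_pow_left₀ (Real.exp_nonneg _) hhalf r
  have hp : ∀ n : ℕ, t ^ n ≤ (1 / 2) ^ n := fun n => pow_le_pow_left₀ ht0.le ht2 n
  have ht8 : t ^ 8 ≤ 1 / 2 := (hp 8).trans (by norm_num)
  set ε : ℝ := t ^ 8 / (1 - t ^ 8) with hε
  have hε0 : 0 ≤ ε := div_nonneg (by positivity) (by linarith)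
  have hεt : ε ≤ 2 * t ^ 8 := by
    rw [hε, div_le_iff₀ (by linarith)]
    nlinarith [pow_pos ht0 8]
  set η : ℝ := (1 / 2) ^ r * Real.exp (-(l + 1) / 2) with hη
  have hη0 : 0 < η := by positivity
  have hηt : t ^ 5 / 2 ≤ η := by
    have h1 : Real.exp (-(l + 1) / 2) = t ^ 4 * Real.exp (-(1 / 2)) := by
      rw [ht, ← Real.exp_nat_mul, ← Real.exp_add, hl]; congr 1; push_cast; ring
    have h2 : 1 / 2 ≤ Real.exp (-(1 / 2)) := by
      have := Real.add_one_le_exp (-(1 / 2)); linarith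
    calc t ^ 5 / 2 = t * (t ^ 4 * (1 / 2)) := by ring
      _ ≤ η := by rw [hη, h1]; gcongr
  have hεη : 2 * ε ≤ η := by
    have h3 := hp 3
    have : t ^ 8 = t ^ 3 * t ^ 5 := by ring
    nlinarith [pow_pos ht0 5]
  have hεr : ε * (r * 9) ≤ 1 := by
    have h7 := hp 7
    have h1 : ε * (r * 9) ≤ 2 * t ^ 8 * (r * 9) := by gcongr
    have h2 : 2 * t ^ 8 * (r * 9) = 18 * t ^ 7 * (t * r) := by ring
    have h3 : 18 * t ^ 7 * (t * r) ≤ 18 * t ^ 7 * 1 := by gcongr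
    norm_num at h7
    linarith
  obtain ⟨M, hMl, hM⟩ := exists_forall_sum_lt hw (2 * l + l)
  have hstate : State w G Set.univ ∅ := ⟨by simp, by simp, by simp, by simp, by simp⟩
  obtain ⟨μ, hμ⟩ := State.exists_randPart hw hM (by linarith)
    (show ε * (1 - Real.exp (-l)) = Real.exp (-l) by
      rw [htl, hε, div_mul_cancel₀ _ (by linarith)]) hε0 hMl hr hεr
    (by
      have : Real.exp (-l / 2) = t ^ 4 := by
        rw [ht, ← Real.exp_nat_mul, hl]; congr 1; push_cast; ring
      rw [this]
      exact (pow_le_of_le_one ht0.le (by linarith) (by norm_num)).trans htp) hη hεη _ ∅ hstate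
  rw [show 48 * (r : ℝ) = 2 * (2 * l + l) by rw [hl]; ring]
  refine ⟨μ, fun z B γ hB hγ hγ1 => ?_⟩
  have key := hμ z B γ [] hB hγ (by linarith) (Set.subset_univ _) ⟨by simp, by simp⟩
  refine le_trans ?_ key
  simp only [List.map_nil, discount, sub_zero, mul_one, one_mul]
  set β := Real.exp (-(2 * γ)) with hβ
  have hβ1 : 1 - 2 * γ ≤ β := by have := Real.add_one_le_exp (-(2 * γ)); linarith
  have hβ2 : β ≤ 1 := Real.exp_le_one_iff.2 (by linarith)
  have h1 : ε * (2 / η) ≤ 1 := by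
    rw [mul_div_assoc', div_le_one hη0]; linarith
  have h2 : (1 - β) * ε * (2 / η) ≤ 1 - β := by
    rw [mul_assoc]; exact mul_le_of_le_one_right (by linarith) h1
  calc Real.exp (-(24 * γ)) = Real.exp (-(2 * (8 * γ))) * Real.exp (-(2 * (4 * γ))) := by
        rw [← Real.exp_add]; congr 1; ring
    _ ≤ (1 - 8 * γ) * (1 - 4 * γ) :=
        mul_le_mul (exp_neg_two_mul_le (by linarith) (by linarith))
          (exp_neg_two_mul_le (by linarith) (by linarith)) (Real.exp_nonneg _) (by linarith)
    _ ≤ _ := mul_le_mul_of_nonneg_left (by linarith) (by linarith)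

namespace RandPart

/-- The partition of the vertex set drawn when the outcome is `i`. -/
def partition (μ : RandPart w G Set.univ L) (i : μ.ι) : Partition V where
  cl := μ.x i
  mem_cl v := (μ.isPart i).mem v trivial
  cl_eq u v h := (μ.isPart i).eq v trivial u h

/-- The distribution of a random partition. -/
noncomputable def toPMF {V : Type} {w : Sym2 V → ℝ} {G : SimpleGraph V}
    (μ : RandPart w G Set.univ L) : PMF (Partition V) :=
  (PMF.ofFintype (fun i => ENNReal.ofReal (μ.p i)) (by
    rw [← ENNReal.ofReal_sum_of_nonneg fun i _ => μ.nonneg i, μ.sum_eq, ENNReal.ofReal_one])).map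
      μ.partition

theorem toOuterMeasure_toPMF {V : Type} {w : Sym2 V → ℝ} {G : SimpleGraph V}
    (μ : RandPart w G Set.univ L) (z : V) (B : Set V) :
    μ.toPMF.toOuterMeasure {P | B ⊆ P.cl z} = ENNReal.ofReal (μ.prob z B) := by
  classical
  rw [toPMF, PMF.toOuterMeasure_map_apply, PMF.toOuterMeasure_ofFintype_apply, tsum_fintype, prob,
    ENNReal.ofReal_sum_of_nonneg]
  · refine Finset.sum_congr rfl fun i _ => ?_
    by_cases h : B ⊆ μ.x i z
    · rw [if_pos h, Set.indicator_of_mem (show i ∈ _ from h)]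
    · rw [if_neg h, Set.indicator_of_notMem (show i ∉ _ from h), ENNReal.ofReal_zero]
  · intro i _
    split_ifs
    exacts [μ.nonneg i, le_rfl]

end RandPart

end Assembly

end Pad

/-- `K_r`-minor-free graphs admit a strong `(c·r, c'/r)`-padded decomposition
scheme, for universal constants `c, c' > 0`. -/
theorem minor_free_strong_padded_decomposition_scheme :
    ∃ c c' : ℝ, 0 < c ∧ 0 < c' ∧
      ∀ (V : Type) [Fintype V], ∀ (G : SimpleGraph V), G.Connected →
      ∀ w : Sym2 V → ℝ, (∀ e, 0 ≤ w e) →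
      ∀ r : ℕ, 2 ≤ r → ¬ Pad.HasCliqueMinor G r →
      ∀ Δ : ℝ, 0 < Δ →
      ∃ D : PMF (Pad.Partition V),
        (∀ P ∈ D.support, Pad.Partition.StronglyBounded w G P Δ) ∧
        ∀ (z : V) (γ : ℝ), 0 ≤ γ → γ ≤ c' / r →
          ENNReal.ofReal (Real.exp (-(c * r * γ))) ≤
            D.toOuterMeasure {P | Pad.ball w G z (γ * Δ) ⊆ P.cl z} := by
  refine ⟨1152, 1 / 768, by norm_num, by norm_num, fun V _ G hG w hw r hr2 hr Δ hΔ => ?_⟩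
  have hr0 : (0 : ℝ) < r := by exact_mod_cast two_pos.trans_le hr2
  set k : ℝ := 48 * r / Δ with hk
  have hk0 : 0 < k := by positivity
  have hkΔ : k * Δ = 48 * r := div_mul_cancel₀ _ hΔ.ne'
  have hw' : ∀ e, 0 ≤ k * w e := fun e => mul_nonneg hk0.le (hw e)
  obtain ⟨μ, hμ⟩ := Pad.exists_randPart_univ (G := G) hw' (by omega) hr
  refine ⟨μ.toPMF, fun P hP v => ?_, fun z γ hγ hγr => ?_⟩
  · obtain ⟨i, -, rfl⟩ := (PMF.mem_support_map_iff _ _ _).1 hP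
    rintro ⟨x, hx⟩ ⟨y, hy⟩
    obtain ⟨a, ha, hxy⟩ := (μ.isPart i).diam v trivial x hx y hy
    have hxy' := hxy.smul k⁻¹
    simp only [inv_mul_cancel_left₀ hk0.ne'] at hxy'
    obtain ⟨p, hp⟩ := hxy'.exists_induce_walk
    refine ⟨p, hp.trans_le ?_⟩
    rw [inv_mul_le_iff₀ hk0, hkΔ]
    exact ha
  · have hγ' : 48 * r * γ ≤ 1 / 16 := by
      rw [le_div_iff₀ hr0] at hγr
      linarith
    have hγ0 : 0 ≤ 48 * r * γ := by positivity
    have h := hμ z _ (48 * r * γ) (Pad.isStar_setOf_walkIn hw' (Set.mem_univ z) hγ0) hγ0 hγ'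
    refine (ENNReal.ofReal_le_ofReal ((Real.exp_le_exp.2 (le_of_eq (by ring))).trans h)).trans ?_
    rw [← μ.toOuterMeasure_toPMF]
    refine MeasureTheory.OuterMeasure.mono _ fun P hP => Set.Subset.trans (fun u hu => ?_) hP
    obtain ⟨a, ha, hua⟩ := Pad.exists_walkIn_wdist hG hw z u
    refine ⟨_, ?_, hua.symm.smul k⟩
    calc k * a ≤ k * (γ * Δ) := mul_le_mul_of_nonneg_left (ha.trans hu) hk0.le
      _ = 48 * r * γ := by rw [← hkΔ]; ring
end
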